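/- arXiv:math/0703721 — 11 statements merged into one kernel-verified Lean document; each statement's English description precedes it below -/
import Mathlib

section
/- Suppose all four 3×3 minor determinants Δ_{αβγ} (1 ≤ α < β < γ ≤ 4) of the weight matrix Θ are nonzero. Then no element of N(Θ) has a vanishing quaternionic pair; that is, for every u ∈ N(Θ) and every α ∈ {1,2,3,4} one has (u_{2α−1}, u_{2α}) ≠ (0,0). -/
open scoped Quaternion
open Finset

noncomputable section

/-- The quaternion unit `i`. -/
def qI : ℍ[ℝ] := ⟨0, 1, 0, 0⟩
/-- The quaternion unit `j`. -/
def qJ : ℍ[ℝ] := ⟨0, 0, 1, 0⟩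
/-- The quaternion unit `k`. -/
def qK : ℍ[ℝ] := ⟨0, 0, 0, 1⟩

/-- Membership in `N(Θ)`, where `Θ` has rows `p, q, l` and the quaternionic pairs of the
point are `(a α, b α)` for `α : Fin 4` (i.e. `a α = u_{2α-1}` and `b α = u_{2α}`):
the sphere equation, the vanishing of the `Sp(1)` moment map, and the vanishing of the
`T³_Θ` moment map. -/
def inN (p q l : Fin 4 → ℤ) (a b : Fin 4 → ℍ[ℝ]) : Prop :=
  (∑ α : Fin 4, (‖a α‖ ^ 2 + ‖b α‖ ^ 2) = 1) ∧
  (∀ e ∈ ({qI, qJ, qK} : Set ℍ[ℝ]),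
    ∑ α : Fin 4, (star (a α) * e * a α + star (b α) * e * b α) = 0) ∧
  (∀ d ∈ ({p, q, l} : Set (Fin 4 → ℤ)),
    ∑ α : Fin 4, (d α : ℝ) • (star (a α) * b α - star (b α) * a α) = 0)

/-- The 3×3 minor `Δ_{αβγ}` of the weight matrix with rows `p, q, l`. -/
def Δ (p q l : Fin 4 → ℤ) (α β γ : Fin 4) : ℤ :=
  Matrix.det !![p α, q α, l α; p β, q β, l β; p γ, q γ, l γ]

lemma aux_imag (w₁ w₂ w₃ : ℍ[ℝ])
    (h : ∀ e : ℍ[ℝ], e.re = 0 → star w₁ * e * w₁ + star w₂ * e * w₂ + star w₃ * e * w₃ = 0)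
    (h1 : ‖w₁‖ ^ 2 ≠ 0) : ‖w₃‖ ^ 2 = ‖w₁‖ ^ 2 + ‖w₂‖ ^ 2 := by
  obtain ⟨e, he, he0, hc⟩ : ∃ e : ℍ[ℝ], e.re = 0 ∧ e ≠ 0 ∧
      e * (w₁ * star w₂) = (w₁ * star w₂) * e := by
    generalize w₁ * star w₂ = g
    by_cases hg : g.im = 0
    · refine ⟨qI, rfl, ?_, ?_⟩
      · intro h
        have := congrArg QuaternionAlgebra.imI h
        simp [qI] at this
      · have hg' : g = (g.re : ℍ[ℝ]) := by
          conv_lhs => rw [← Quaternion.re_add_im g, hg, add_zero]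
        rw [hg']
        exact (Quaternion.coe_commutes g.re qI).symm
    · refine ⟨g.im, by simp, hg, ?_⟩
      have hcm : Commute g.im ((g.re : ℍ[ℝ]) + g.im) :=
        (Quaternion.coe_commute g.re g.im).symm.add_right (Commute.refl _)
      rw [Quaternion.re_add_im] at hcm
      exact hcm
  have key : ∀ w : ℍ[ℝ], star w * w = ((‖w‖ ^ 2 : ℝ) : ℍ[ℝ]) := by
    intro w
    rw [Quaternion.star_mul_self, Quaternion.normSq_eq_norm_mul_self, sq]
  have hAB : (‖w₂‖ ^ 2) • (star w₁ * e * w₁) = (‖w₁‖ ^ 2) • (star w₂ * e * w₂) := by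
    have e1 : star w₁ * e * w₁ * (star w₂ * w₂) = (star w₁ * w₁) * (star w₂ * e * w₂) := by
      calc _ = star w₁ * (e * (w₁ * star w₂)) * w₂ := by simp only [mul_assoc]
        _ = _ := by rw [hc]; simp only [mul_assoc]
    rw [key, key, Quaternion.mul_coe_eq_smul, Quaternion.coe_mul_eq_smul] at e1
    exact e1
  have hC : (‖w₁‖ ^ 2) • (star w₃ * e * w₃) = (-(‖w₁‖ ^ 2 + ‖w₂‖ ^ 2)) • (star w₁ * e * w₁) := by
    linear_combination (norm := module) (‖w₁‖ ^ 2) • h e he + hAB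
  have hn := congrArg norm hC
  rw [norm_smul, norm_smul, norm_neg, Real.norm_of_nonneg (by positivity),
    Real.norm_of_nonneg (by positivity)] at hn
  simp only [norm_mul, norm_star] at hn
  have he' : ‖e‖ ≠ 0 := norm_ne_zero_iff.2 he0
  apply mul_left_cancel₀ (mul_ne_zero h1 he')
  linear_combination hn

lemma aux_zero (w₁ w₂ w₃ : ℍ[ℝ])
    (h : ∀ e : ℍ[ℝ], e.re = 0 → star w₁ * e * w₁ + star w₂ * e * w₂ + star w₃ * e * w₃ = 0) :
    ‖w₁‖ ^ 2 = 0 := by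
  by_contra h1
  have a1 := aux_imag w₁ w₂ w₃ h h1
  have a2 := aux_imag w₁ w₃ w₂ (fun e he => by rw [← h e he]; abel) h1
  apply h1
  linarith

lemma aux_pair (a b : ℍ[ℝ]) (h : star a * b - star b * a = 0) :
    ∃ w : ℍ[ℝ], ‖w‖ ^ 2 = ‖a‖ ^ 2 + ‖b‖ ^ 2 ∧
      ∀ e : ℍ[ℝ], star w * e * w = star a * e * a + star b * e * b := by
  by_cases ha : a = 0
  · exact ⟨b, by simp [ha], by simp [ha]⟩
  have hs : star (star a * b) = star a * b := by
    rw [star_mul, star_star]; exact (sub_eq_zero.1 h).symm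
  rw [Quaternion.star_eq_self] at hs
  set r := (star a * b).re with hr
  have hb : b = (r / ‖a‖ ^ 2) • a := by
    have h2 : a * (star a * b) = (‖a‖ ^ 2) • b := by
      rw [← mul_assoc, Quaternion.self_mul_star, Quaternion.normSq_eq_norm_mul_self,
        Quaternion.coe_mul_eq_smul, sq]
    rw [hs, Quaternion.mul_coe_eq_smul] at h2
    have hn : ‖a‖ ^ 2 ≠ 0 := pow_ne_zero 2 (norm_ne_zero_iff.2 ha)
    rw [div_eq_inv_mul, mul_smul, h2, smul_smul, inv_mul_cancel₀ hn, one_smul]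
  generalize r / ‖a‖ ^ 2 = t at hb
  have ht : √(1 + t ^ 2) * √(1 + t ^ 2) = 1 + t ^ 2 := Real.mul_self_sqrt (by positivity)
  refine ⟨√(1 + t ^ 2) • a, ?_, ?_⟩
  · rw [hb, norm_smul, norm_smul, mul_pow, mul_pow, Real.norm_eq_abs, Real.norm_eq_abs, sq_abs,
      sq_abs, sq, ht]
    ring
  · intro e
    rw [hb]
    simp only [Quaternion.star_smul, smul_mul_assoc, mul_smul_comm, smul_smul, ht]
    module

lemma aux_triple (a₁ a₂ a₃ b₁ b₂ b₃ : ℍ[ℝ]) (p₁ p₂ p₃ q₁ q₂ q₃ l₁ l₂ l₃ : ℤ)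
    (hd : Matrix.det !![p₁, q₁, l₁; p₂, q₂, l₂; p₃, q₃, l₃] ≠ 0)
    (hn : ‖a₁‖ ^ 2 + ‖b₁‖ ^ 2 + (‖a₂‖ ^ 2 + ‖b₂‖ ^ 2) + (‖a₃‖ ^ 2 + ‖b₃‖ ^ 2) = 1)
    (he : ∀ e ∈ ({qI, qJ, qK} : Set ℍ[ℝ]),
      (star a₁ * e * a₁ + star b₁ * e * b₁) + (star a₂ * e * a₂ + star b₂ * e * b₂)
        + (star a₃ * e * a₃ + star b₃ * e * b₃) = 0)
    (hp : (p₁ : ℝ) • (star a₁ * b₁ - star b₁ * a₁) + (p₂ : ℝ) • (star a₂ * b₂ - star b₂ * a₂)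
      + (p₃ : ℝ) • (star a₃ * b₃ - star b₃ * a₃) = 0)
    (hq : (q₁ : ℝ) • (star a₁ * b₁ - star b₁ * a₁) + (q₂ : ℝ) • (star a₂ * b₂ - star b₂ * a₂)
      + (q₃ : ℝ) • (star a₃ * b₃ - star b₃ * a₃) = 0)
    (hl : (l₁ : ℝ) • (star a₁ * b₁ - star b₁ * a₁) + (l₂ : ℝ) • (star a₂ * b₂ - star b₂ * a₂)
      + (l₃ : ℝ) • (star a₃ * b₃ - star b₃ * a₃) = 0) : False := by
  rw [Matrix.det_fin_three] at hd
  simp at hd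
  have hd' : (p₁ * q₂ * l₃ - p₁ * l₂ * q₃ - q₁ * p₂ * l₃ + q₁ * l₂ * p₃ + l₁ * p₂ * q₃
      - l₁ * q₂ * p₃ : ℝ) ≠ 0 := by exact_mod_cast hd
  have c₁ : star a₁ * b₁ - star b₁ * a₁ = 0 := by
    refine (smul_eq_zero.1 ?_).resolve_left hd'
    linear_combination (norm := module) (q₂ * l₃ - l₂ * q₃ : ℝ) • hp + (l₂ * p₃ - p₂ * l₃ : ℝ) • hq
      + (p₂ * q₃ - q₂ * p₃ : ℝ) • hl
  have c₂ : star a₂ * b₂ - star b₂ * a₂ = 0 := by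
    refine (smul_eq_zero.1 ?_).resolve_left hd'
    linear_combination (norm := module) (q₃ * l₁ - l₃ * q₁ : ℝ) • hp + (l₃ * p₁ - p₃ * l₁ : ℝ) • hq
      + (p₃ * q₁ - q₃ * p₁ : ℝ) • hl
  have c₃ : star a₃ * b₃ - star b₃ * a₃ = 0 := by
    refine (smul_eq_zero.1 ?_).resolve_left hd'
    linear_combination (norm := module) (q₁ * l₂ - l₁ * q₂ : ℝ) • hp + (l₁ * p₂ - p₁ * l₂ : ℝ) • hq
      + (p₁ * q₂ - q₁ * p₂ : ℝ) • hl
  obtain ⟨w₁, n₁, e₁⟩ := aux_pair a₁ b₁ c₁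
  obtain ⟨w₂, n₂, e₂⟩ := aux_pair a₂ b₂ c₂
  obtain ⟨w₃, n₃, e₃⟩ := aux_pair a₃ b₃ c₃
  simp only [← e₁, ← e₂, ← e₃, ← n₁, ← n₂, ← n₃] at he hn
  have H : ∀ e : ℍ[ℝ], e.re = 0 →
      star w₁ * e * w₁ + star w₂ * e * w₂ + star w₃ * e * w₃ = 0 := by
    intro e h0
    have hI := he qI (by simp)
    have hJ := he qJ (by simp)
    have hK := he qK (by simp)
    have hE : e = e.imI • qI + e.imJ • qJ + e.imK • qK := by
      have f0 : qI.re = 0 := rfl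
      have f1 : qI.imI = 1 := rfl
      have f2 : qI.imJ = 0 := rfl
      have f3 : qI.imK = 0 := rfl
      have f4 : qJ.re = 0 := rfl
      have f5 : qJ.imI = 0 := rfl
      have f6 : qJ.imJ = 1 := rfl
      have f7 : qJ.imK = 0 := rfl
      have f8 : qK.re = 0 := rfl
      have f9 : qK.imI = 0 := rfl
      have f10 : qK.imJ = 0 := rfl
      have f11 : qK.imK = 1 := rfl
      ext <;> simp [h0, f0, f1, f2, f3, f4, f5, f6, f7, f8, f9, f10, f11]
    rw [hE]
    simp only [mul_add, add_mul, smul_mul_assoc, mul_smul_comm]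
    linear_combination (norm := module) e.imI • hI + e.imJ • hJ + e.imK • hK
  have z₁ := aux_zero w₁ w₂ w₃ H
  have z₂ := aux_zero w₂ w₁ w₃ (fun e he => by rw [← H e he]; abel)
  have z₃ := aux_zero w₃ w₁ w₂ (fun e he => by rw [← H e he]; abel)
  linarith

/-- Lemma 1.1: if all four minors `Δ_{αβγ}` are nonzero, then no element
of `N(Θ)` has a vanishing quaternionic pair. -/
theorem statement0 (p q l : Fin 4 → ℤ)
    (hΔ : ∀ α β γ : Fin 4, α < β → β < γ → Δ p q l α β γ ≠ 0)
    (a b : Fin 4 → ℍ[ℝ]) (hu : inN p q l a b) :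
    ∀ α : Fin 4, (a α, b α) ≠ (0, 0) := by
  intro δ hδ
  obtain ⟨ha, hb⟩ := Prod.mk.inj hδ
  obtain ⟨hn, he, hd⟩ := hu
  have hp := hd p (by simp)
  have hq := hd q (by simp)
  have hl := hd l (by simp)
  rw [Fin.sum_univ_four] at hn hp hq hl
  simp only [Fin.sum_univ_four] at he
  fin_cases δ
  · change a 0 = 0 at ha
    change b 0 = 0 at hb
    refine aux_triple (a 1) (a 2) (a 3) (b 1) (b 2) (b 3) _ _ _ _ _ _ _ _ _
      (hΔ 1 2 3 (by decide) (by decide)) ?_ (fun e h => ?_) ?_ ?_ ?_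
    · rw [← hn, ha, hb]; simp
    · rw [← he e h, ha, hb]; simp
    · rw [← hp, ha, hb]; simp
    · rw [← hq, ha, hb]; simp
    · rw [← hl, ha, hb]; simp
  · change a 1 = 0 at ha
    change b 1 = 0 at hb
    refine aux_triple (a 0) (a 2) (a 3) (b 0) (b 2) (b 3) _ _ _ _ _ _ _ _ _
      (hΔ 0 2 3 (by decide) (by decide)) ?_ (fun e h => ?_) ?_ ?_ ?_
    · rw [← hn, ha, hb]; simp
    · rw [← he e h, ha, hb]; simp
    · rw [← hp, ha, hb]; simp
    · rw [← hq, ha, hb]; simp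
    · rw [← hl, ha, hb]; simp
  · change a 2 = 0 at ha
    change b 2 = 0 at hb
    refine aux_triple (a 0) (a 1) (a 3) (b 0) (b 1) (b 3) _ _ _ _ _ _ _ _ _
      (hΔ 0 1 3 (by decide) (by decide)) ?_ (fun e h => ?_) ?_ ?_ ?_
    · rw [← hn, ha, hb]; simp
    · rw [← he e h, ha, hb]; simp
    · rw [← hp, ha, hb]; simp
    · rw [← hq, ha, hb]; simp
    · rw [← hl, ha, hb]; simp
  · change a 3 = 0 at ha
    change b 3 = 0 at hb
    refine aux_triple (a 0) (a 1) (a 2) (b 0) (b 1) (b 2) _ _ _ _ _ _ _ _ _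
      (hΔ 0 1 2 (by decide) (by decide)) ?_ (fun e h => ?_) ?_ ?_ ?_
    · rw [← hn, ha, hb]; simp
    · rw [← he e h, ha, hb]; simp
    · rw [← hp, ha, hb]; simp
    · rw [← hq, ha, hb]; simp
    · rw [← hl, ha, hb]; simp
end
end

section
/- Let u, u′ ∈ ℍ with (u,u′) ≠ (0,0), let λ ∈ ℍ and θ ∈ ℝ, and suppose cos θ · u + sin θ · u′ = λu and −sin θ · u + cos θ · u′ = λu′. Then Re(λ) = cos θ and Im(λ)·(|u|² + |u′|²) = sin θ · (u′ū − uū′). Consequently, if u ∈ ℍ⁸ has no vanishing quaternionic pair and λ ∈ ℍ, θ₁,…,θ₄ ∈ ℝ satisfy these two equations for each quaternionic pair (u_{2α−1}, u_{2α}) with angle θ_α, then cos θ₁ = cos θ₂ = cos θ₃ = cos θ₄ = Re(λ), and if moreover |λ| = 1 then sin θ_α = ±sin θ₁ for every α. -/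
open scoped Quaternion

noncomputable section

theorem pair_aux (u u' : ℍ[ℝ]) (hne : (u, u') ≠ (0, 0)) (lam : ℍ[ℝ]) (θ : ℝ)
    (h1 : Real.cos θ • u + Real.sin θ • u' = lam * u)
    (h2 : (-Real.sin θ) • u + Real.cos θ • u' = lam * u') :
    lam.re = Real.cos θ ∧
        (‖u‖ ^ 2 + ‖u'‖ ^ 2) • (lam - ((lam.re : ℝ) : ℍ[ℝ])) =
          Real.sin θ • (u' * star u - u * star u') := by
  have hN : ‖u‖ ^ 2 + ‖u'‖ ^ 2 ≠ 0 := by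
    intro h
    apply hne
    have ha : ‖u‖ ^ 2 = 0 := by nlinarith [sq_nonneg ‖u‖, sq_nonneg ‖u'‖]
    have hb : ‖u'‖ ^ 2 = 0 := by nlinarith [sq_nonneg ‖u‖, sq_nonneg ‖u'‖]
    simp at ha hb
    simp [ha, hb]
  have hs : ∀ v : ℍ[ℝ], v * star v = (((‖v‖ ^ 2 : ℝ)) : ℍ[ℝ]) := by
    intro v
    rw [Quaternion.self_mul_star, Quaternion.normSq_eq_norm_mul_self, sq]
  have key : (‖u‖ ^ 2 + ‖u'‖ ^ 2) • lam = (‖u‖ ^ 2 + ‖u'‖ ^ 2) • ((Real.cos θ : ℝ) : ℍ[ℝ])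
      + Real.sin θ • (u' * star u - u * star u') := by
    have e : (‖u‖ ^ 2 + ‖u'‖ ^ 2) • lam = lam * u * star u + lam * u' * star u' := by
      rw [mul_assoc, mul_assoc, hs, hs, ← mul_add, ← Quaternion.coe_add,
        Quaternion.mul_coe_eq_smul]
    rw [e, ← h1, ← h2]
    simp only [add_mul, smul_mul_assoc, hs, smul_sub, neg_smul, neg_mul, Quaternion.smul_coe,
      mul_comm (Real.cos θ), Quaternion.coe_add]
    abel
  have hre : lam.re = Real.cos θ := by
    have := congrArg (fun q : ℍ[ℝ] => q.re) key
    simp at this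
    apply mul_left_cancel₀ hN
    linear_combination this
  refine ⟨hre, ?_⟩
  rw [smul_sub, key, hre]
  abel

/-- for a quaternionic pair `(u, u') ≠ (0,0)` with `λ ∈ ℍ`, `θ ∈ ℝ`
satisfying the fixed point equations, one has `Re(λ) = cos θ` and
`(|u|² + |u'|²) Im(λ) = sin θ (u'ū − uū')`; consequently, for a point of `ℍ⁸` with no
vanishing quaternionic pair and angles `θ₁, …, θ₄`, all `cos θ_α` equal `Re(λ)`, and if
`|λ| = 1` then `sin θ_α = ± sin θ₁` for every `α`. -/
theorem statement1 :
    (∀ (u u' : ℍ[ℝ]), (u, u') ≠ (0, 0) → ∀ (lam : ℍ[ℝ]) (θ : ℝ),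
      Real.cos θ • u + Real.sin θ • u' = lam * u →
      (-Real.sin θ) • u + Real.cos θ • u' = lam * u' →
      lam.re = Real.cos θ ∧
        (‖u‖ ^ 2 + ‖u'‖ ^ 2) • (lam - ((lam.re : ℝ) : ℍ[ℝ])) =
          Real.sin θ • (u' * star u - u * star u')) ∧
    (∀ (a b : Fin 4 → ℍ[ℝ]) (lam : ℍ[ℝ]) (θ : Fin 4 → ℝ),
      (∀ α, (a α, b α) ≠ (0, 0)) →
      (∀ α, Real.cos (θ α) • a α + Real.sin (θ α) • b α = lam * a α) →
      (∀ α, (-Real.sin (θ α)) • a α + Real.cos (θ α) • b α = lam * b α) →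
      (∀ α, Real.cos (θ α) = lam.re) ∧
        (‖lam‖ = 1 → ∀ α, Real.sin (θ α) = Real.sin (θ 0) ∨
          Real.sin (θ α) = -Real.sin (θ 0))) := by
  refine ⟨fun u u' hne lam θ h1 h2 => pair_aux u u' hne lam θ h1 h2, ?_⟩
  intro a b lam θ hne h1 h2
  have hc : ∀ α, Real.cos (θ α) = lam.re := fun α =>
    (pair_aux (a α) (b α) (hne α) lam (θ α) (h1 α) (h2 α)).1.symm
  refine ⟨hc, fun _ α => ?_⟩
  apply sq_eq_sq_iff_eq_or_eq_neg.mp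
  rw [Real.sin_sq, Real.sin_sq, hc, hc]
end
end

section
/- Suppose all four minors Δ_{αβγ} of Θ are nonzero and all eight determinants ^{1±2}□^{1±3}_{1±4} are nonzero. Then the action of Sp(1) × T³_Θ on N(Θ) is locally free: for every u ∈ N(Θ), the set of (λ, t, s, r), with λ a unit quaternion and (t,s,r) ∈ [0,2π)³, such that for every α ∈ {1,2,3,4} one has cos θ_α · u_{2α−1} + sin θ_α · u_{2α} = λ u_{2α−1} and −sin θ_α · u_{2α−1} + cos θ_α · u_{2α} = λ u_{2α}, where θ_α = p_α t + q_α s + l_α r, is finite. -/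
open scoped Quaternion
open Finset

noncomputable section

/-- The determinant `^{1±2}□^{1±3}_{1±4}` with signs `s₂, s₃, s₄ ∈ {1, -1}`. -/
def box (p q l : Fin 4 → ℤ) (s₂ s₃ s₄ : ℤ) : ℤ :=
  Matrix.det !![p 0 + s₂ * p 1, q 0 + s₂ * q 1, l 0 + s₂ * l 1;
                p 0 + s₃ * p 2, q 0 + s₃ * q 2, l 0 + s₃ * l 2;
                p 0 + s₄ * p 3, q 0 + s₄ * q 3, l 0 + s₄ * l 3]


theorem aux_fin (D : ℤ) (hD : D ≠ 0) :
    Set.Finite {t : ℝ | t ∈ Set.Ico 0 (2 * Real.pi) ∧ ∃ n : ℤ, (D : ℝ) * t = n * Real.pi} := by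
  have hp := Real.pi_pos
  refine Set.Finite.subset ((Set.finite_Icc (-(2 * |D|)) (2 * |D|)).image
    (fun n : ℤ => (n : ℝ) * Real.pi / D)) ?_
  rintro t ⟨⟨h0, h1⟩, n, hn⟩
  have hD' : (D : ℝ) ≠ 0 := by exact_mod_cast hD
  refine ⟨n, ?_, ?_⟩
  · have h2 : |(n : ℝ)| * Real.pi ≤ (2 * |(D : ℝ)|) * Real.pi := by
      have : |(n : ℝ)| * Real.pi = |(D : ℝ)| * t := by
        rw [← abs_of_nonneg h0, ← abs_mul, hn, abs_mul, abs_of_pos hp]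
      rw [this]
      nlinarith [abs_nonneg (D : ℝ)]
    have h3 : |(n : ℝ)| ≤ 2 * |(D : ℝ)| := le_of_mul_le_mul_right h2 hp
    have h4 : |n| ≤ 2 * |D| := by exact_mod_cast h3
    exact abs_le.mp h4
  · simp only
    rw [← hn]; field_simp

theorem aux_fin3 (D : ℤ) (hD : D ≠ 0) :
    Set.Finite {x : ℝ × ℝ × ℝ | x.1 ∈ Set.Ico 0 (2 * Real.pi) ∧
      x.2.1 ∈ Set.Ico 0 (2 * Real.pi) ∧ x.2.2 ∈ Set.Ico 0 (2 * Real.pi) ∧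
      (∃ n : ℤ, (D : ℝ) * x.1 = n * Real.pi) ∧ (∃ n : ℤ, (D : ℝ) * x.2.1 = n * Real.pi) ∧
      (∃ n : ℤ, (D : ℝ) * x.2.2 = n * Real.pi)} := by
  refine Set.Finite.subset ((aux_fin D hD).prod ((aux_fin D hD).prod (aux_fin D hD))) ?_
  rintro ⟨t, s, r⟩ ⟨h1, h2, h3, h4, h5, h6⟩
  exact ⟨⟨h1, h4⟩, ⟨h2, h5⟩, ⟨h3, h6⟩⟩

theorem aux_cramer (a b c d e f g h i : ℤ) (t s r : ℝ)
    (h1 : ∃ n : ℤ, a * t + b * s + c * r = n * Real.pi)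
    (h2 : ∃ n : ℤ, d * t + e * s + f * r = n * Real.pi)
    (h3 : ∃ n : ℤ, g * t + h * s + i * r = n * Real.pi) (D : ℤ)
    (hD : D = Matrix.det !![a, b, c; d, e, f; g, h, i]) :
    (∃ n : ℤ, (D : ℝ) * t = n * Real.pi) ∧ (∃ n : ℤ, (D : ℝ) * s = n * Real.pi) ∧
      (∃ n : ℤ, (D : ℝ) * r = n * Real.pi) := by
  obtain ⟨n1, h1⟩ := h1
  obtain ⟨n2, h2⟩ := h2
  obtain ⟨n3, h3⟩ := h3
  rw [Matrix.det_fin_three] at hD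
  simp at hD
  subst hD
  refine ⟨⟨(e*i-f*h)*n1 - (b*i-c*h)*n2 + (b*f-c*e)*n3, ?_⟩,
    ⟨-(d*i-f*g)*n1 + (a*i-c*g)*n2 - (a*f-c*d)*n3, ?_⟩,
    ⟨(d*h-e*g)*n1 - (a*h-b*g)*n2 + (a*e-b*d)*n3, ?_⟩⟩
  · push_cast
    linear_combination ((e*i-f*h):ℝ)*h1 - ((b*i-c*h):ℝ)*h2 + ((b*f-c*e):ℝ)*h3
  · push_cast
    linear_combination (-(d*i-f*g):ℝ)*h1 + ((a*i-c*g):ℝ)*h2 - ((a*f-c*d):ℝ)*h3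
  · push_cast
    linear_combination ((d*h-e*g):ℝ)*h1 - ((a*h-b*g):ℝ)*h2 + ((a*e-b*d):ℝ)*h3

/-- If all `cos` agree then some box-determinant multiple is in `πℤ`. -/
theorem aux_cos (x y : ℝ) (h : Real.cos x = Real.cos y) :
    ∃ ε : ℤ, ε ∈ ({1, -1} : Set ℤ) ∧ ∃ n : ℤ, x + ε * y = n * Real.pi := by
  rw [Real.cos_eq_cos_iff] at h
  obtain ⟨k, h | h⟩ := h
  · exact ⟨-1, by simp, -(2 * k), by push_cast; linarith⟩
  · exact ⟨1, by simp, 2 * k, by push_cast; linarith⟩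

theorem aux_mulstar (a : ℍ[ℝ]) : a * star a = ((‖a‖ ^ 2 : ℝ) : ℍ[ℝ]) := by
  rw [Quaternion.self_mul_star, Quaternion.normSq_eq_norm_mul_self, sq]

theorem aux_starmul (a : ℍ[ℝ]) : star a * a = ((‖a‖ ^ 2 : ℝ) : ℍ[ℝ]) := by
  rw [Quaternion.star_mul_self, Quaternion.normSq_eq_norm_mul_self, sq]

/-- A unit quaternion satisfies its characteristic equation. -/
theorem aux_char (x : ℍ[ℝ]) (hx : ‖x‖ = 1) : x * x = (2 * x.re) • x - 1 := by
  have h1 : x * star x = 1 := by rw [aux_mulstar, hx]; simp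
  have h2 : star x = ((2 * x.re : ℝ) : ℍ[ℝ]) - x := by
    ext <;> simp <;> ring
  rw [h2, mul_sub, Quaternion.mul_coe_eq_smul] at h1
  rw [← h1]; abel

theorem aux_re (a b x : ℍ[ℝ]) (c s : ℝ) (hcs : s ^ 2 + c ^ 2 = 1) (hx : ‖x‖ = 1)
    (h1 : c • a + s • b = x * a) (h2 : (-s) • a + c • b = x * b) (hab : a ≠ 0 ∨ b ≠ 0) :
    c = x.re := by
  have hx0 : x ≠ 0 := by rintro rfl; simp at hx
  have ch := aux_char x hx
  have ea : (2 * x.re - 2 * c) • (x * a) = 0 := by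
    have e1 : x * x * a = c • (x * a) + s • (x * b) := by
      rw [mul_assoc, ← h1, mul_add, mul_smul_comm, mul_smul_comm, ← h1, ← h2]
    rw [ch, sub_mul, smul_mul_assoc, one_mul] at e1
    have e2 : s • (x * b) = c • (x * a) - a := by
      rw [← h1, ← h2]
      linear_combination (norm := module) (-1 : ℝ) • hcs • a
    rw [e2] at e1
    have := sub_eq_zero.mpr e1
    rw [← this]; module
  have eb : (2 * x.re - 2 * c) • (x * b) = 0 := by
    have e1 : x * x * b = (-s) • (x * a) + c • (x * b) := by
      rw [mul_assoc, ← h2, mul_add, mul_smul_comm, mul_smul_comm, ← h1, ← h2]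
    rw [ch, sub_mul, smul_mul_assoc, one_mul] at e1
    have e2 : (-s) • (x * a) = c • (x * b) - b := by
      rw [← h1, ← h2]
      linear_combination (norm := module) (-1 : ℝ) • hcs • b
    rw [e2] at e1
    have := sub_eq_zero.mpr e1
    rw [← this]; module
  have : 2 * x.re - 2 * c = 0 := by
    rcases hab with h | h
    · exact (smul_eq_zero.mp ea).resolve_right (mul_ne_zero hx0 h)
    · exact (smul_eq_zero.mp eb).resolve_right (mul_ne_zero hx0 h)
  linarith

theorem aux_sa (y : ℍ[ℝ]) (h : star y = y) : y = ((y.re : ℝ) : ℍ[ℝ]) :=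
  Quaternion.star_eq_self.mp h

/-- Conjugation to a self-adjoint element forces `x` to be real. -/
theorem aux_real (a x : ℍ[ℝ]) (ha : a ≠ 0) (h : star (star a * (x * a)) = star a * (x * a)) :
    star x = x := by
  simp only [star_mul, star_star, mul_assoc] at h
  have := mul_left_cancel₀ (star_ne_zero.mpr ha) h
  exact mul_right_cancel₀ ha this

theorem aux_sin (a b x : ℍ[ℝ]) (c s : ℝ) (hcs : s ^ 2 + c ^ 2 = 1) (hx : ‖x‖ = 1)
    (h1 : c • a + s • b = x * a) (h2 : (-s) • a + c • b = x * b) (hab : a ≠ 0 ∨ b ≠ 0)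
    (hw : star a * b - star b * a = 0) : s = 0 := by
  have hc := aux_re a b x c s hcs hx h1 h2 hab
  have hw' := sub_eq_zero.mp hw
  have hs : star x = x := by
    rcases hab with h | h
    · apply aux_real a x h
      rw [← h1]
      simp only [star_mul, star_add, Quaternion.star_smul, star_star, mul_add, add_mul,
        mul_smul_comm, smul_mul_assoc, hw']
    · apply aux_real b x h
      rw [← h2]
      simp only [star_mul, star_add, Quaternion.star_smul, star_star, mul_add, add_mul,
        mul_smul_comm, smul_mul_assoc, hw']
  have hr := aux_sa x hs
  rw [hr, Quaternion.norm_coe, ← hc] at hx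
  have : c ^ 2 = 1 := by rw [← sq_abs, ← Real.norm_eq_abs, hx]; simp
  have : s ^ 2 = 0 := by linarith
  exact pow_eq_zero_iff (two_ne_zero) |>.mp this

/-- A pair with `Im (ā b) = 0` is as good as one quaternion. -/
theorem aux_w (a b : ℍ[ℝ]) (hw : star a * b - star b * a = 0) :
    ∃ w : ℍ[ℝ], (∀ e : ℍ[ℝ], star a * e * a + star b * e * b = star w * e * w) ∧
      ‖w‖ ^ 2 = ‖a‖ ^ 2 + ‖b‖ ^ 2 := by
  by_cases ha : a = 0
  · exact ⟨b, by simp [ha], by simp [ha]⟩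
  have hn : ‖a‖ ^ 2 ≠ 0 := pow_ne_zero _ (norm_ne_zero_iff.mpr ha)
  have h1 : star (star a * b) = star a * b := by
    simp only [star_mul, star_star]; exact (sub_eq_zero.mp hw).symm
  have h2 := aux_sa _ h1
  obtain ⟨y, hy⟩ : ∃ y : ℝ, b = y • a := by
    refine ⟨(star a * b).re / ‖a‖ ^ 2, ?_⟩
    have h3 : ‖a‖ ^ 2 • b = (star a * b).re • a := by
      rw [← Quaternion.coe_mul_eq_smul, ← aux_mulstar, mul_assoc, h2,
        Quaternion.mul_coe_eq_smul]
      simp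
    rw [div_eq_inv_mul, mul_smul, ← h3, smul_smul, inv_mul_cancel₀ hn, one_smul]
  have hpos : (0 : ℝ) ≤ 1 + y ^ 2 := by positivity
  have hsq := Real.mul_self_sqrt hpos
  refine ⟨Real.sqrt (1 + y ^ 2) • a, fun e => ?_, ?_⟩
  · rw [hy]
    simp only [Quaternion.star_smul, mul_smul_comm, smul_mul_assoc, smul_smul, hsq]
    module
  · rw [hy, norm_smul, norm_smul, mul_pow, mul_pow, Real.norm_eq_abs, Real.norm_eq_abs,
      sq_abs, sq_abs, sq, hsq]
    ring

theorem aux_ij : qI * qJ = qK := by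
  ext <;> simp only [Quaternion.re_mul, Quaternion.imI_mul, Quaternion.imJ_mul,
    Quaternion.imK_mul] <;> simp [qI, qJ, qK]

theorem aux_conj (w e f : ℍ[ℝ]) :
    (star w * e * w) * (star w * f * w) = ‖w‖ ^ 2 • (star w * (e * f) * w) := by
  have : (star w * e * w) * (star w * f * w) = star w * e * (w * star w) * f * w := by
    simp only [mul_assoc]
  rw [this, aux_mulstar, Quaternion.mul_coe_eq_smul]
  simp only [smul_mul_assoc, mul_assoc]

theorem aux_two (v w : ℍ[ℝ]) (h : ∀ e ∈ ({qI, qJ, qK} : Set ℍ[ℝ]),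
    star v * e * v + star w * e * w = 0) : ‖v‖ ^ 2 + ‖w‖ ^ 2 = 0 := by
  have hi := eq_neg_of_add_eq_zero_left (h qI (by simp))
  have hj := eq_neg_of_add_eq_zero_left (h qJ (by simp))
  have hk := eq_neg_of_add_eq_zero_left (h qK (by simp))
  have hK : qK ≠ 0 := by
    intro h
    have := congrArg (fun x : ℍ[ℝ] => x.imK) h
    simp [qK] at this
  have e1 := aux_conj v qI qJ
  rw [hi, hj, neg_mul_neg, aux_conj, aux_ij, hk] at e1
  have e2 : (‖v‖ ^ 2 + ‖w‖ ^ 2) • (star w * qK * w) = 0 := by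
    rw [add_smul, e1]; simp
  rcases smul_eq_zero.mp e2 with h0 | h0
  · exact h0
  · have hw : w = 0 := by simpa [hK] using h0
    have hv : v = 0 := by
      rw [h0] at hk
      simpa [hK] using hk
    simp [hv, hw]

theorem aux_lin (p q l : Fin 4 → ℤ) (i j k : Fin 4) (hD : Δ p q l i j k ≠ 0)
    (A B C : ℍ[ℝ])
    (h : ∀ d ∈ ({p, q, l} : Set (Fin 4 → ℤ)),
      (d i : ℝ) • A + (d j : ℝ) • B + (d k : ℝ) • C = 0) : A = 0 ∧ B = 0 ∧ C = 0 := by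
  have hp := h p (by simp)
  have hq := h q (by simp)
  have hl := h l (by simp)
  have hD' : ((Δ p q l i j k : ℤ) : ℝ) ≠ 0 := by exact_mod_cast hD
  have e : ((Δ p q l i j k : ℤ) : ℝ) = p i * q j * l k - p i * l j * q k - q i * p j * l k
      + q i * l j * p k + l i * p j * q k - l i * q j * p k := by
    rw [Δ, Matrix.det_fin_three]; simp
  refine ⟨?_, ?_, ?_⟩
  · refine (smul_eq_zero.mp ?_).resolve_left hD'
    rw [e]
    linear_combination (norm := module) ((q j : ℝ) * l k - l j * q k) • hp
      + ((l j : ℝ) * p k - p j * l k) • hq + ((p j : ℝ) * q k - q j * p k) • hl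
  · refine (smul_eq_zero.mp ?_).resolve_left hD'
    rw [e]
    linear_combination (norm := module) ((l i : ℝ) * q k - q i * l k) • hp
      + ((p i : ℝ) * l k - l i * p k) • hq + ((q i : ℝ) * p k - p i * q k) • hl
  · refine (smul_eq_zero.mp ?_).resolve_left hD'
    rw [e]
    linear_combination (norm := module) ((q i : ℝ) * l j - l i * q j) • hp
      + ((l i : ℝ) * p j - p i * l j) • hq + ((p i : ℝ) * q j - q i * p j) • hl

theorem aux_split (z : Fin 4) : ∃ i j k : Fin 4, i < j ∧ j < k ∧
    (∀ f : Fin 4 → ℍ[ℝ], ∑ α, f α = f i + f j + f k + f z) ∧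
    (∀ f : Fin 4 → ℝ, ∑ α, f α = f i + f j + f k + f z) := by
  fin_cases z
  · exact ⟨1, 2, 3, by decide, by decide, fun f => by rw [Fin.sum_univ_four]; simp only [Fin.zero_eta]; abel,
      fun f => by rw [Fin.sum_univ_four]; simp only [Fin.zero_eta]; abel⟩
  · exact ⟨0, 2, 3, by decide, by decide, fun f => by rw [Fin.sum_univ_four]; simp only [Fin.mk_one]; abel,
      fun f => by rw [Fin.sum_univ_four]; simp only [Fin.mk_one]; abel⟩
  · exact ⟨0, 1, 3, by decide, by decide, fun f => by rw [Fin.sum_univ_four]; simp only [Fin.reduceFinMk]; abel,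
      fun f => by rw [Fin.sum_univ_four]; simp only [Fin.reduceFinMk]; abel⟩
  · exact ⟨0, 1, 2, by decide, by decide, fun f => by rw [Fin.sum_univ_four]; simp only [Fin.reduceFinMk],
      fun f => by rw [Fin.sum_univ_four]; simp only [Fin.reduceFinMk]⟩

theorem aux_three (p q l : Fin 4 → ℤ)
    (hΔ : ∀ α β γ : Fin 4, α < β → β < γ → Δ p q l α β γ ≠ 0)
    (a b : Fin 4 → ℍ[ℝ]) (hu : inN p q l a b) (z : Fin 4) (hz : a z = 0 ∧ b z = 0) :
    ∃ i j k : Fin 4, i < j ∧ j < k ∧ ∀ α ∈ ({i, j, k} : Set (Fin 4)),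
      (a α ≠ 0 ∨ b α ≠ 0) ∧ star (a α) * b α - star (b α) * a α = 0 := by
  obtain ⟨i, j, k, hij, hjk, hs, hs'⟩ := aux_split z
  obtain ⟨h1, h2, h3⟩ := hu
  rw [hs'] at h1
  simp only [hs, hz.1, hz.2, mul_zero, sub_zero, smul_zero, add_zero] at h2 h3
  obtain ⟨wi, wj, wk⟩ := aux_lin p q l i j k (hΔ i j k hij hjk) _ _ _ h3
  obtain ⟨u, hu, hu'⟩ := aux_w _ _ wi
  obtain ⟨v, hv, hv'⟩ := aux_w _ _ wj
  obtain ⟨w, hw, hw'⟩ := aux_w _ _ wk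
  simp only [hu, hv, hw] at h2
  rw [← hu', ← hv', ← hw', hz.1, hz.2] at h1
  simp only [norm_zero] at h1
  refine ⟨i, j, k, hij, hjk, ?_⟩
  rintro α (rfl | rfl | rfl)
  · refine ⟨?_, wi⟩
    by_contra! hc
    have h0 : ‖u‖ ^ 2 = 0 := by rw [hu', hc.1, hc.2]; simp
    have hu0 : u = 0 := by simpa using h0
    have := aux_two v w (fun e he => by simpa [hu0] using h2 e he)
    linarith
  · refine ⟨?_, wj⟩
    by_contra! hc
    have h0 : ‖v‖ ^ 2 = 0 := by rw [hv', hc.1, hc.2]; simp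
    have hu0 : v = 0 := by simpa using h0
    have := aux_two u w (fun e he => by simpa [hu0] using h2 e he)
    linarith
  · refine ⟨?_, wk⟩
    by_contra! hc
    have h0 : ‖w‖ ^ 2 = 0 := by rw [hw', hc.1, hc.2]; simp
    have hu0 : w = 0 := by simpa using h0
    have := aux_two u v (fun e he => by simpa [hu0] using h2 e he)
    linarith

/-- Proposition 1.1: if all minors `Δ_{αβγ}` and all eight determinants
`^{1±2}□^{1±3}_{1±4}` are nonzero, the action of `Sp(1) × T³_Θ` on `N(Θ)` is locally free:
for every point of `N(Θ)`, the set of `(λ, t, s, r)` fixing the point is finite. -/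
theorem statement2 (p q l : Fin 4 → ℤ)
    (hΔ : ∀ α β γ : Fin 4, α < β → β < γ → Δ p q l α β γ ≠ 0)
    (hbox : ∀ s₂ s₃ s₄ : ℤ, s₂ ∈ ({1, -1} : Set ℤ) → s₃ ∈ ({1, -1} : Set ℤ) →
      s₄ ∈ ({1, -1} : Set ℤ) → box p q l s₂ s₃ s₄ ≠ 0)
    (a b : Fin 4 → ℍ[ℝ]) (hu : inN p q l a b) :
    Set.Finite {x : ℍ[ℝ] × ℝ × ℝ × ℝ |
      ‖x.1‖ = 1 ∧ x.2.1 ∈ Set.Ico 0 (2 * Real.pi) ∧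
      x.2.2.1 ∈ Set.Ico 0 (2 * Real.pi) ∧ x.2.2.2 ∈ Set.Ico 0 (2 * Real.pi) ∧
      ∀ α : Fin 4,
        Real.cos ((p α : ℝ) * x.2.1 + (q α : ℝ) * x.2.2.1 + (l α : ℝ) * x.2.2.2) • a α +
            Real.sin ((p α : ℝ) * x.2.1 + (q α : ℝ) * x.2.2.1 + (l α : ℝ) * x.2.2.2) • b α =
          x.1 * a α ∧
        (-Real.sin ((p α : ℝ) * x.2.1 + (q α : ℝ) * x.2.2.1 + (l α : ℝ) * x.2.2.2)) • a α +
            Real.cos ((p α : ℝ) * x.2.1 + (q α : ℝ) * x.2.2.1 + (l α : ℝ) * x.2.2.2) • b α =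
          x.1 * b α} := by
  have hne : ∃ α, a α ≠ 0 ∨ b α ≠ 0 := by
    by_contra! hc
    have := hu.1
    simp [hc] at this
  -- it suffices that the torus parts form a finite set
  have key : ∃ S : Set ℤ, S.Finite ∧ (∀ D ∈ S, D ≠ 0) ∧ ∀ (x : ℍ[ℝ]) (t s r : ℝ), ‖x‖ = 1 →
      (∀ α : Fin 4,
        Real.cos ((p α : ℝ) * t + (q α : ℝ) * s + (l α : ℝ) * r) • a α +
            Real.sin ((p α : ℝ) * t + (q α : ℝ) * s + (l α : ℝ) * r) • b α = x * a α ∧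
        (-Real.sin ((p α : ℝ) * t + (q α : ℝ) * s + (l α : ℝ) * r)) • a α +
            Real.cos ((p α : ℝ) * t + (q α : ℝ) * s + (l α : ℝ) * r) • b α = x * b α) →
      ∃ D ∈ S, (∃ n : ℤ, (D : ℝ) * t = n * Real.pi) ∧ (∃ n : ℤ, (D : ℝ) * s = n * Real.pi) ∧
        (∃ n : ℤ, (D : ℝ) * r = n * Real.pi) := by
    by_cases hz : ∃ z, a z = 0 ∧ b z = 0
    · obtain ⟨z, hz⟩ := hz
      obtain ⟨i, j, k, hij, hjk, h⟩ := aux_three p q l hΔ a b hu z hz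
      refine ⟨{Δ p q l i j k}, Set.finite_singleton _, ?_, ?_⟩
      · rintro D rfl
        exact hΔ i j k hij hjk
      · intro x t s r hx hfix
        have hsin : ∀ α ∈ ({i, j, k} : Set (Fin 4)),
            ∃ n : ℤ, (p α : ℝ) * t + (q α : ℝ) * s + (l α : ℝ) * r = n * Real.pi := by
          intro α hα
          have h0 := aux_sin (a α) (b α) x _ _ (Real.sin_sq_add_cos_sq _) hx (hfix α).1
            (hfix α).2 (h α hα).1 (h α hα).2
          obtain ⟨n, hn⟩ := Real.sin_eq_zero_iff.mp h0
          exact ⟨n, hn.symm⟩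
        exact ⟨_, rfl, aux_cramer _ _ _ _ _ _ _ _ _ t s r (hsin i (by simp)) (hsin j (by simp))
          (hsin k (by simp)) _ rfl⟩
    · push Not at hz
      have hz' : ∀ α, a α ≠ 0 ∨ b α ≠ 0 := fun α => by
        by_cases h : a α = 0
        · exact Or.inr (hz α h)
        · exact Or.inl h
      refine ⟨(fun e : ℤ × ℤ × ℤ => box p q l e.1 e.2.1 e.2.2) ''
        (({1, -1} : Set ℤ) ×ˢ (({1, -1} : Set ℤ) ×ˢ ({1, -1} : Set ℤ))), ?_, ?_, ?_⟩
      · exact Set.Finite.image _ ((Set.toFinite _).prod ((Set.toFinite _).prod (Set.toFinite _)))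
      · rintro D ⟨⟨e, f, g⟩, ⟨he, hf, hg⟩, rfl⟩
        exact hbox e f g he hf hg
      · intro x t s r hx hfix
        have hcos : ∀ α, Real.cos ((p α : ℝ) * t + (q α : ℝ) * s + (l α : ℝ) * r) = x.re :=
          fun α => aux_re (a α) (b α) x _ _ (Real.sin_sq_add_cos_sq _) hx (hfix α).1
            (hfix α).2 (hz' α)
        obtain ⟨e, he, n1, h1⟩ := aux_cos _ _ ((hcos 0).trans (hcos 1).symm)
        obtain ⟨f, hf, n2, h2⟩ := aux_cos _ _ ((hcos 0).trans (hcos 2).symm)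
        obtain ⟨g, hg, n3, h3⟩ := aux_cos _ _ ((hcos 0).trans (hcos 3).symm)
        refine ⟨_, ⟨(e, f, g), ⟨he, hf, hg⟩, rfl⟩, aux_cramer _ _ _ _ _ _ _ _ _ t s r
          ⟨n1, ?_⟩ ⟨n2, ?_⟩ ⟨n3, ?_⟩ _ rfl⟩
        · rw [← h1]; push_cast; ring
        · rw [← h2]; push_cast; ring
        · rw [← h3]; push_cast; ring
  obtain ⟨S, hS, hS0, hkey⟩ := key
  have hfin := hS.biUnion (fun D hD => aux_fin3 D (hS0 D hD))
  refine Set.Finite.of_finite_image (f := Prod.snd) (hfin.subset ?_) ?_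
  · rintro _ ⟨⟨x, t, s, r⟩, ⟨hx, ht, hs, hr, hfix⟩, rfl⟩
    obtain ⟨D, hD, h⟩ := hkey x t s r hx hfix
    exact Set.mem_biUnion hD ⟨ht, hs, hr, h⟩
  · rintro ⟨x, t, s, r⟩ ⟨_, _, _, _, hfix⟩ ⟨x', y⟩ ⟨_, _, _, _, hfix'⟩ hxy
    obtain rfl : (t, s, r) = y := hxy
    obtain ⟨α, hα⟩ := hne
    have : x = x' := by
      rcases hα with h | h
      · exact mul_right_cancel₀ h ((hfix α).1.symm.trans (hfix' α).1)
      · exact mul_right_cancel₀ h ((hfix α).2.symm.trans (hfix' α).2)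
    rw [this]
end
end

section
/- Let λ, ρ ∈ ℍ with |λ| = 1 and ρ a unit complex number regarded as a quaternion, let θ ∈ ℝ with sin 2θ ≠ 0, and let (u, u′) ∈ ℍ² satisfy cos θ·u + sin θ·u′ = λuρ and −sin θ·u + cos θ·u′ = λu′ρ. Then λ·Im(u′ū)·λ̄ = Im(u′ū). In particular, if Im(u′ū) = c·i for some nonzero real number c, then, writing λ = ε + jσ with ε, σ ∈ ℂ, one has σ = 0, i.e. λ is a unit complex number. -/
open scoped Quaternion

noncomputable section

/-- The imaginary part of a quaternion, `Im u = u - Re u`. -/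
def qIm (u : ℍ[ℝ]) : ℍ[ℝ] := u - ((u.re : ℝ) : ℍ[ℝ])

/-- Conjugation by a unit quaternion commutes with the imaginary part. -/
theorem qIm_conj (l w : ℍ[ℝ]) (h : l * star l = 1) :
    l * qIm w * star l = qIm (l * w * star l) := by
  have hn : l.re ^ 2 + l.imI ^ 2 + l.imJ ^ 2 + l.imK ^ 2 = 1 := by
    have := congrArg QuaternionAlgebra.re h
    simp at this
    linarith
  ext
  · simp [qIm]
    ring
  all_goals
    simp [qIm]
    ring

theorem star_of_norm_one (l : ℍ[ℝ]) (h : ‖l‖ = 1) : l * star l = 1 := by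
  rw [Quaternion.self_mul_star, Quaternion.normSq_eq_norm_mul_self, h]
  simp

theorem qIm_rot (c s : ℝ) (h : s ^ 2 + c ^ 2 = 1) (u v : ℍ[ℝ]) :
    qIm (((-s) • u + c • v) * star (c • u + s • v)) = qIm (v * star u) := by
  ext
  · simp [qIm]
  · simp [qIm]
    linear_combination (v.imI * u.re - v.re * u.imI - v.imJ * u.imK + v.imK * u.imJ) * h
  · simp [qIm]
    linear_combination (v.imJ * u.re - v.re * u.imJ - v.imK * u.imI + v.imI * u.imK) * h
  · simp [qIm]
    linear_combination (v.imK * u.re - v.re * u.imK - v.imI * u.imJ + v.imJ * u.imI) * h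

/-- key computation of Proposition 2.1: if `|λ| = 1`, `ρ` is a unit
complex number regarded as a quaternion, `sin 2θ ≠ 0`, and `(u, u')` satisfies the twistor
fixed-point equations, then `λ · Im(u'ū) · λ̄ = Im(u'ū)`; in particular if
`Im(u'ū) = c·i` with `c ≠ 0` then the `j`-part of `λ` vanishes, i.e. `λ` is a unit complex
number. -/
theorem statement8 (lam ρ : ℍ[ℝ]) (hlam : ‖lam‖ = 1)
    (hρJ : ρ.imJ = 0) (hρK : ρ.imK = 0) (hρ : ‖ρ‖ = 1)
    (θ : ℝ) (hθ : Real.sin (2 * θ) ≠ 0)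
    (u u' : ℍ[ℝ])
    (h1 : Real.cos θ • u + Real.sin θ • u' = lam * u * ρ)
    (h2 : (-Real.sin θ) • u + Real.cos θ • u' = lam * u' * ρ) :
    lam * qIm (u' * star u) * star lam = qIm (u' * star u) ∧
    (∀ c : ℝ, c ≠ 0 → qIm (u' * star u) = c • qI → lam.imJ = 0 ∧ lam.imK = 0) := by
  have hl := star_of_norm_one lam hlam
  have hr := star_of_norm_one ρ hρ
  have key : lam * qIm (u' * star u) * star lam = qIm (u' * star u) := by
    rw [qIm_conj _ _ hl, ← qIm_rot _ _ (Real.sin_sq_add_cos_sq θ) u u', h1, h2]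
    congr 1
    calc lam * (u' * star u) * star lam = lam * u' * 1 * (star u * star lam) := by
          simp [mul_assoc]
      _ = lam * u' * ρ * star (lam * u * ρ) := by
          rw [← hr]
          simp [mul_assoc]
  refine ⟨key, fun c hc h => ?_⟩
  have hl' : star lam * lam = 1 := by
    rw [Quaternion.star_mul_self, ← Quaternion.self_mul_star, hl]
  rw [h] at key
  have comm : lam * (c • qI) = (c • qI) * lam := by
    calc lam * (c • qI) = lam * (c • qI) * (star lam * lam) := by rw [hl', mul_one]
      _ = (c • qI) * lam := by rw [← mul_assoc, key]
  have hJ := congrArg QuaternionAlgebra.imJ comm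
  have hK := congrArg QuaternionAlgebra.imK comm
  have e0 : qI.re = 0 := rfl
  have e1 : qI.imI = 1 := rfl
  have e2 : qI.imJ = 0 := rfl
  have e3 : qI.imK = 0 := rfl
  simp only [Quaternion.imJ_mul, Quaternion.imK_mul, Quaternion.re_smul, Quaternion.imI_smul,
    Quaternion.imJ_smul, Quaternion.imK_smul, e0, e1, e2, e3, smul_eq_mul] at hJ hK
  constructor
  · apply mul_left_cancel₀ hc
    linarith
  · apply mul_left_cancel₀ hc
    linarith
end
end

section
/- Suppose all eight determinants ^{1±2}□^{1±3}_{1±4} of Θ are nonzero. Then for every choice of signs s₁, s₂, s₃, s₄ ∈ {±1}, there is no u ∈ N(Θ) such that for every α ∈ {1,2,3,4}: z_{2α} = s_α·i·z_{2α−1} and w_{2α} = −s_α·i·w_{2α−1}. In other words, the eigenspace families S^{(+,−)} and S^{(−,+)} (where the complex and j-parts of each quaternionic pair carry opposite rotation signs) have empty intersection with N(Θ). -/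
open scoped Quaternion
open Finset

noncomputable section

/-- The complex part `z` of a quaternion `u = z + jw` in the identification `ℍ = ℂ ⊕ ℂj`. -/
def Qz (u : ℍ[ℝ]) : ℂ := ⟨u.re, u.imI⟩

/-- The complex part `w` of a quaternion `u = z + jw` in the identification `ℍ = ℂ ⊕ ℂj`. -/
def Qw (u : ℍ[ℝ]) : ℂ := ⟨u.imJ, -u.imK⟩

lemma qI_re : qI.re = 0 := rfl
lemma qI_imI : qI.imI = 1 := rfl
lemma qI_imJ : qI.imJ = 0 := rfl
lemma qI_imK : qI.imK = 0 := rfl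

/-- Linear algebra: the four linear equations force the vector to vanish. -/
lemma aux_lin_s9 (p q l : Fin 4 → ℤ)
    (hbox : ∀ s₂ s₃ s₄ : ℤ, s₂ ∈ ({1, -1} : Set ℤ) → s₃ ∈ ({1, -1} : Set ℤ) →
      s₄ ∈ ({1, -1} : Set ℤ) → box p q l s₂ s₃ s₄ ≠ 0)
    (s : Fin 4 → ℤ) (hs : ∀ α, s α = 1 ∨ s α = -1) (x : Fin 4 → ℝ)
    (h0 : ∑ α, x α = 0)
    (hd : ∀ d ∈ ({p, q, l} : Set (Fin 4 → ℤ)), ∑ α, (d α : ℝ) * (s α * x α) = 0) :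
    ∀ α, x α = 0 := by
  have hm : ∀ α, -(s 0 * s α) ∈ ({1, -1} : Set ℤ) := by
    intro α
    rcases hs 0 with h | h <;> rcases hs α with h' | h' <;> simp [h, h']
  have hb := hbox _ _ _ (hm 1) (hm 2) (hm 3)
  have hs0 : (s 0 : ℝ) * s 0 = 1 := by
    rcases hs 0 with h | h <;> simp [h]
  have key : ∀ d ∈ ({p, q, l} : Set (Fin 4 → ℤ)),
      x 1 * ((d 0 : ℝ) + -(s 0 * s 1) * d 1) + x 2 * ((d 0 : ℝ) + -(s 0 * s 2) * d 2)
        + x 3 * ((d 0 : ℝ) + -(s 0 * s 3) * d 3) = 0 := by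
    intro d hdm
    have h := hd d hdm
    simp only [Fin.sum_univ_four] at h h0
    linear_combination (-(s 0 : ℝ)) * h + (d 0 : ℝ) * h0 + (d 0 : ℝ) * x 0 * hs0
  have kp := key p (by simp)
  have kq := key q (by simp)
  have kl := key l (by simp)
  unfold _root_.box at hb
  have hb' := (Int.cast_ne_zero (α := ℝ)).2 hb
  rw [Int.cast_det] at hb'
  have hv : (![x 1, x 2, x 3] : Fin 3 → ℝ) = 0 := by
    refine Matrix.eq_zero_of_vecMul_eq_zero hb' ?_
    ext i
    fin_cases i
    · simpa [Matrix.vecMul, dotProduct, Fin.sum_univ_three] using kp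
    · simpa [Matrix.vecMul, dotProduct, Fin.sum_univ_three] using kq
    · simpa [Matrix.vecMul, dotProduct, Fin.sum_univ_three] using kl
  have h1 : x 1 = 0 := congrFun hv 0
  have h2 : x 2 = 0 := congrFun hv 1
  have h3 : x 3 = 0 := congrFun hv 2
  have h00 : x 0 = 0 := by
    simp only [Fin.sum_univ_four] at h0
    linarith
  intro α
  fin_cases α <;> assumption

/-- Proposition 2.5: if all eight determinants `^{1±2}□^{1±3}_{1±4}` are
nonzero, then for any sign vector `s ∈ {±1}⁴` there is no point of `N(Θ)` whose
quaternionic pairs satisfy `z_{2α} = s_α i z_{2α-1}` and `w_{2α} = −s_α i w_{2α-1}`. -/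
theorem statement9 (p q l : Fin 4 → ℤ)
    (hbox : ∀ s₂ s₃ s₄ : ℤ, s₂ ∈ ({1, -1} : Set ℤ) → s₃ ∈ ({1, -1} : Set ℤ) →
      s₄ ∈ ({1, -1} : Set ℤ) → box p q l s₂ s₃ s₄ ≠ 0)
    (s : Fin 4 → ℤ) (hs : ∀ α, s α = 1 ∨ s α = -1) :
    ¬ ∃ a b : Fin 4 → ℍ[ℝ], inN p q l a b ∧
      ∀ α : Fin 4,
        Qz (b α) = (s α : ℂ) * Complex.I * Qz (a α) ∧
        Qw (b α) = -(s α : ℂ) * Complex.I * Qw (a α) := by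
  rintro ⟨a, b, ⟨hn, he, hd⟩, hab⟩
  have hb : ∀ α, b α = (s α : ℝ) • (qI * a α) := by
    intro α
    obtain ⟨h1, h2⟩ := hab α
    have e1 := congrArg Complex.re h1
    have e2 := congrArg Complex.im h1
    have e3 := congrArg Complex.re h2
    have e4 := congrArg Complex.im h2
    simp [Qz, Qw] at e1 e2 e3 e4
    ext <;> simp [qI_re, qI_imI, qI_imJ, qI_imK] <;> linarith
  have hss : ∀ α, (s α : ℝ) * s α = 1 := by
    intro α
    rcases hs α with h | h <;> simp [h]
  have hsI : star qI = -qI := by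
    ext <;> simp [qI_re, qI_imI, qI_imJ, qI_imK]
  have hII : qI * qI = -1 := by
    ext <;> simp [qI_re, qI_imI, qI_imJ, qI_imK]
  have hsb : ∀ α, star (b α) = (s α : ℝ) • (star (a α) * -qI) := by
    intro α
    rw [hb α, Quaternion.star_smul, star_mul, hsI]
  have hv : ∀ α, star (a α) * qI * a α + star (b α) * qI * b α
      = (2 : ℝ) • (star (a α) * qI * a α) := by
    intro α
    have h1 : star (b α) * qI * b α
        = ((s α : ℝ) * s α) • (star (a α) * (-qI * (qI * qI)) * a α) := by
      rw [hsb α, hb α]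
      simp only [smul_mul_assoc, mul_smul_comm,
        smul_smul, mul_assoc]
    rw [h1, hss, hII, one_smul, two_smul]
    simp
  have hw : ∀ α, star (a α) * b α - star (b α) * a α
      = (2 : ℝ) • ((s α : ℝ) • (star (a α) * qI * a α)) := by
    intro α
    rw [hsb α, hb α]
    simp only [smul_mul_assoc, mul_smul_comm,
      mul_assoc, mul_neg, neg_mul, smul_neg, sub_neg_eq_add, two_smul]
  have h0 : ∑ α, star (a α) * qI * a α = 0 := by
    have h := he qI (by simp)
    simp only [hv, ← Finset.smul_sum] at h
    exact (smul_eq_zero.1 h).resolve_left two_ne_zero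
  have hd' : ∀ d ∈ ({p, q, l} : Set (Fin 4 → ℤ)),
      ∑ α, (d α : ℝ) • ((s α : ℝ) • (star (a α) * qI * a α)) = 0 := by
    intro d hdm
    have h := hd d hdm
    simp only [hw] at h
    simp only [smul_comm _ (2 : ℝ), ← Finset.smul_sum] at h
    exact (smul_eq_zero.1 h).resolve_left two_ne_zero
  have lin : ∀ f : ℍ[ℝ] →ₗ[ℝ] ℝ, ∀ α, f (star (a α) * qI * a α) = 0 := by
    intro f
    apply aux_lin_s9 p q l hbox s hs
    · rw [← map_sum, h0, map_zero]
    · intro d hdm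
      have h := congrArg f (hd' d hdm)
      simpa only [map_sum, map_smul, smul_eq_mul, map_zero] using h
  have hz : ∀ α, star (a α) * qI * a α = 0 := by
    intro α
    ext
    · exact lin (QuaternionAlgebra.reₗ _ _ _) α
    · exact lin (QuaternionAlgebra.imIₗ _ _ _) α
    · exact lin (QuaternionAlgebra.imJₗ _ _ _) α
    · exact lin (QuaternionAlgebra.imKₗ _ _ _) α
  have hI : qI ≠ 0 := by
    intro h
    have := congrArg QuaternionAlgebra.imI h
    simp [qI] at this
  have ha : ∀ α, a α = 0 := by
    intro α
    have := hz α
    simpa [hI] using this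
  simp [hb, ha] at hn
end
end

section
/- Suppose all four minors Δ_{αβγ} and all eight determinants ^{1±2}□^{1±3}_{1±4} of Θ are nonzero. Then there is no u ∈ N(Θ) all of whose quaternionic pairs are of line type, i.e. such that for every α ∈ {1,2,3,4} there is a sign s_α ∈ {±1} with either (w_{2α−1} = w_{2α} = 0 and z_{2α} = s_α·i·z_{2α−1}) or (z_{2α−1} = z_{2α} = 0 and w_{2α} = s_α·i·w_{2α−1}). (This is the key nonexistence step in Proposition 2.7, which bounds by two the number of quaternionic pairs of a point of N(Θ) lying in the lines ^±V₁^α, ^±V₂^α.) -/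
open scoped Quaternion
open Finset

noncomputable section

lemma pair_aux_s11 (a b : ℍ[ℝ]) (h : ∃ s : ℤ, (s = 1 ∨ s = -1) ∧
        ((Qw a = 0 ∧ Qw b = 0 ∧ Qz b = (s : ℂ) * Complex.I * Qz a) ∨
         (Qz a = 0 ∧ Qz b = 0 ∧ Qw b = (s : ℂ) * Complex.I * Qw a))) :
    ∃ (x : ℝ) (s t : ℤ), (s = 1 ∨ s = -1) ∧ (t = 1 ∨ t = -1) ∧
      ‖a‖ ^ 2 + ‖b‖ ^ 2 = 2 * s * x ∧
      (star a * qI * a + star b * qI * b).imI = 2 * t * x ∧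
      (star a * b - star b * a).imI = 2 * x := by
  obtain ⟨s, hs, h⟩ := h
  have hn : ∀ c : ℍ[ℝ], ‖c‖ ^ 2 = c.re ^ 2 + c.imI ^ 2 + c.imJ ^ 2 + c.imK ^ 2 := by
    intro c
    rw [← Quaternion.normSq_def', Quaternion.normSq_eq_norm_mul_self, sq]
  have e0 : qI.re = 0 := rfl
  have e1 : qI.imI = 1 := rfl
  have e2 : qI.imJ = 0 := rfl
  have e3 : qI.imK = 0 := rfl
  have hm : ∀ c : ℍ[ℝ], (star c * qI * c).imI = c.re ^ 2 + c.imI ^ 2 - c.imJ ^ 2 - c.imK ^ 2 := by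
    intro c
    simp [e0, e1, e2, e3]
    ring
  have hc : (star a * b - star b * a).imI
      = 2 * (a.re * b.imI - a.imI * b.re - a.imJ * b.imK + a.imK * b.imJ) := by
    simp
    ring
  rw [Quaternion.imI_add, hm, hm, hc, hn, hn]
  simp only [Qw, Qz, Complex.ext_iff] at h
  rcases hs with rfl | rfl <;>
    rcases h with ⟨⟨h1, h2⟩, ⟨h3, h4⟩, h5, h6⟩ | ⟨⟨h1, h2⟩, ⟨h3, h4⟩, h5, h6⟩ <;>
    simp at h1 h2 h3 h4 h5 h6 <;> rw [h1, h2, h3, h4]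
  · refine ⟨a.re ^ 2 + a.imI ^ 2, 1, 1, by simp, by simp, ?_, ?_, ?_⟩ <;>
      rw [h5, h6] <;> push_cast <;> ring
  · have h7 : b.imK = -a.imJ := by linarith
    refine ⟨a.imJ ^ 2 + a.imK ^ 2, 1, -1, by simp, by simp, ?_, ?_, ?_⟩ <;>
      rw [h5, h7] <;> push_cast <;> ring
  · refine ⟨-(a.re ^ 2 + a.imI ^ 2), -1, -1, by simp, by simp, ?_, ?_, ?_⟩ <;>
      rw [h5, h6] <;> push_cast <;> ring
  · refine ⟨-(a.imJ ^ 2 + a.imK ^ 2), -1, 1, by simp, by simp, ?_, ?_, ?_⟩ <;>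
      rw [h5, h6] <;> push_cast <;> ring

/-- nonexistence step of Proposition 2.7: if all minors `Δ_{αβγ}` and
all eight determinants `^{1±2}□^{1±3}_{1±4}` are nonzero, then no point of `N(Θ)` has all
of its quaternionic pairs of line type (i.e. in one of the lines `^±V₁^α`, `^±V₂^α`). -/
theorem statement11 (p q l : Fin 4 → ℤ)
    (hΔ : ∀ α β γ : Fin 4, α < β → β < γ → Δ p q l α β γ ≠ 0)
    (hbox : ∀ s₂ s₃ s₄ : ℤ, s₂ ∈ ({1, -1} : Set ℤ) → s₃ ∈ ({1, -1} : Set ℤ) →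
      s₄ ∈ ({1, -1} : Set ℤ) → box p q l s₂ s₃ s₄ ≠ 0) :
    ¬ ∃ a b : Fin 4 → ℍ[ℝ], inN p q l a b ∧
      ∀ α : Fin 4, ∃ s : ℤ, (s = 1 ∨ s = -1) ∧
        ((Qw (a α) = 0 ∧ Qw (b α) = 0 ∧ Qz (b α) = (s : ℂ) * Complex.I * Qz (a α)) ∨
         (Qz (a α) = 0 ∧ Qz (b α) = 0 ∧ Qw (b α) = (s : ℂ) * Complex.I * Qw (a α))) := by
  rintro ⟨a, b, ⟨hN, hI, hd⟩, hl⟩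
  choose x s t hs ht h1 h2 h3 using fun α => pair_aux_s11 (a α) (b α) (hl α)
  have hI' := congrArg (fun c : ℍ[ℝ] => c.imI) (hI qI (by simp))
  have hD : ∀ d ∈ ({p, q, l} : Set (Fin 4 → ℤ)),
      (d 0 : ℝ) * x 0 + d 1 * x 1 + d 2 * x 2 + d 3 * x 3 = 0 := by
    intro d hd'
    have h := congrArg (fun c : ℍ[ℝ] => c.imI) (hd d hd')
    simp only [Fin.sum_univ_four, Quaternion.imI_add, Quaternion.imI_smul, h3, smul_eq_mul,
      Quaternion.imI_zero] at h
    linarith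
  have hp := hD p (by simp)
  have hq := hD q (by simp)
  have hr := hD l (by simp)
  have hA : ∀ α, (star (a α) * qI * a α).imI + (star (b α) * qI * b α).imI = 2 * t α * x α := by
    intro α
    rw [← h2 α, Quaternion.imI_add]
  have hT : (t 0 : ℝ) * x 0 + t 1 * x 1 + t 2 * x 2 + t 3 * x 3 = 0 := by
    simp only [Fin.sum_univ_four, Quaternion.imI_add, hA, Quaternion.imI_zero] at hI'
    linarith
  simp only [Fin.sum_univ_four, h1] at hN
  have hsq : ∀ α, (t α : ℝ) * t α = 1 := by
    intro α
    rcases ht α with h | h <;> simp [h]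
  have hsgn : ∀ α, -(t 0 * t α) ∈ ({1, -1} : Set ℤ) := by
    intro α
    rcases ht 0 with h | h <;> rcases ht α with h' | h' <;> simp [h, h']
  have hb := hbox _ _ _ (hsgn 1) (hsgn 2) (hsgn 3)
  have hx0 : x 0 = -(t 0 * t 1) * x 1 + -(t 0 * t 2) * x 2 + -(t 0 * t 3) * x 3 := by
    linear_combination (t 0 : ℝ) * hT - x 0 * hsq 0
  -- the signed coordinates lie in the kernel of the transposed box matrix
  have key : ∀ d : Fin 4 → ℤ, (d 0 : ℝ) * x 0 + d 1 * x 1 + d 2 * x 2 + d 3 * x 3 = 0 →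
      (-(t 0 * t 1) * x 1) * (d 0 + -(t 0 * t 1) * d 1 : ℝ)
      + (-(t 0 * t 2) * x 2) * (d 0 + -(t 0 * t 2) * d 2 : ℝ)
      + (-(t 0 * t 3) * x 3) * (d 0 + -(t 0 * t 3) * d 3 : ℝ) = 0 := by
    intro d h
    have e : ∀ α, (t 0 * t α : ℝ) * (t 0 * t α) = 1 := by
      intro α
      linear_combination (t α * t α : ℝ) * hsq 0 + hsq α
    linear_combination h - (d 0 : ℝ) * hx0 + x 1 * d 1 * e 1 + x 2 * d 2 * e 2 + x 3 * d 3 * e 3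
  have kp := key p hp
  have kq := key q hq
  have kl := key l hr
  have hb' : ((box p q l (-(t 0 * t 1)) (-(t 0 * t 2)) (-(t 0 * t 3)) : ℤ) : ℝ) ≠ 0 := by
    exact_mod_cast hb
  set M : Matrix (Fin 3) (Fin 3) ℤ :=
    !![p 0 + -(t 0 * t 1) * p 1, q 0 + -(t 0 * t 1) * q 1, l 0 + -(t 0 * t 1) * l 1;
       p 0 + -(t 0 * t 2) * p 2, q 0 + -(t 0 * t 2) * q 2, l 0 + -(t 0 * t 2) * l 2;
       p 0 + -(t 0 * t 3) * p 3, q 0 + -(t 0 * t 3) * q 3, l 0 + -(t 0 * t 3) * l 3] with hM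
  have hdet : (M.map (Int.castRingHom ℝ)).det ≠ 0 := by
    rw [← RingHom.mapMatrix_apply, ← RingHom.map_det]
    exact hb'
  have hv := Matrix.eq_zero_of_vecMul_eq_zero (v := ![(-(t 0 * t 1) * x 1 : ℝ),
    -(t 0 * t 2) * x 2, -(t 0 * t 3) * x 3]) hdet (by
      funext i
      fin_cases i <;> simp [Matrix.vecMul, dotProduct, Fin.sum_univ_three, hM] <;> linarith)
  have v0 := congrFun hv 0
  have v1 := congrFun hv 1
  have v2 := congrFun hv 2
  have ht0 : ∀ α, (t α : ℝ) ≠ 0 := by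
    intro α h
    have := hsq α
    simp [h] at this
  simp [ht0] at v0 v1 v2
  simp [v0, v1, v2] at hx0
  simp [v0, v1, v2, hx0] at hN
end
end

section
/- Let θ ∈ ℝ and ε, σ ∈ ℂ with |ε|² + |σ|² = 1. Then det M̃(θ,ε,σ) = 0 if and only if e^{iθ} = Re(ε) + i·√((Im ε)² + |σ|²) or e^{−iθ} = Re(ε) + i·√((Im ε)² + |σ|²). -/
noncomputable section

open Complex

/-- The matrix `M̃(θ,ε,σ)` encoding the 3-Sasakian fixed-point equations of a quaternionic
pair, in the identification `ℍ = ℂ ⊕ ℂj`. -/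
def Mtilde (θ : ℝ) (ε σ : ℂ) : Matrix (Fin 4) (Fin 4) ℂ :=
  !![0, -σ, -(Real.sin θ : ℂ), (Real.cos θ : ℂ) - (starRingEnd ℂ) ε;
     -σ, 0, (Real.cos θ : ℂ) - (starRingEnd ℂ) ε, (Real.sin θ : ℂ);
     -(Real.sin θ : ℂ), (Real.cos θ : ℂ) - ε, 0, (starRingEnd ℂ) σ;
     (Real.cos θ : ℂ) - ε, (Real.sin θ : ℂ), (starRingEnd ℂ) σ, 0]

/-- Lemma 2.7: for `|ε|² + |σ|² = 1`, `det M̃(θ,ε,σ) = 0` iff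
`e^{iθ} = Re ε + i√((Im ε)² + |σ|²)` or `e^{−iθ} = Re ε + i√((Im ε)² + |σ|²)`. -/
theorem statement12 (θ : ℝ) (ε σ : ℂ)
    (hlam : Complex.normSq ε + Complex.normSq σ = 1) :
    (Mtilde θ ε σ).det = 0 ↔
      (Complex.exp ((θ : ℂ) * Complex.I) =
          (ε.re : ℂ) + Complex.I * (Real.sqrt (ε.im ^ 2 + Complex.normSq σ) : ℝ) ∨
       Complex.exp (-(θ : ℂ) * Complex.I) =
          (ε.re : ℂ) + Complex.I * (Real.sqrt (ε.im ^ 2 + Complex.normSq σ) : ℝ)) := by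
  have hdet : (Mtilde θ ε σ).det = (((4 * (Real.cos θ - ε.re) ^ 2 : ℝ)) : ℂ) := by
    have h1 : Real.sin θ ^ 2 = 1 - Real.cos θ ^ 2 := Real.sin_sq θ
    have hS : (Real.sin θ : ℂ) ^ 2 = 1 - (Real.cos θ : ℂ) ^ 2 := by exact_mod_cast h1
    have hE : ε * (starRingEnd ℂ) ε + σ * (starRingEnd ℂ) σ = 1 := by
      rw [Complex.mul_conj, Complex.mul_conj]; exact_mod_cast hlam
    have hR : ε + (starRingEnd ℂ) ε = 2 * (ε.re : ℂ) := by
      rw [Complex.add_conj]; push_cast; ring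
    have hq : (starRingEnd ℂ) ε = 2 * (ε.re : ℂ) - ε := by linear_combination hR
    push_cast
    simp only [← Complex.ofReal_cos]
    unfold Mtilde
    rw [hq] at hE ⊢
    generalize (Real.sin θ : ℂ) = s at *
    generalize (Real.cos θ : ℂ) = c at *
    generalize (starRingEnd ℂ) σ = t at *
    generalize (ε.re : ℂ) = r at *
    have hX : (!![0, -σ, -s, c - (2 * r - ε); -σ, 0, c - (2 * r - ε), s; -s, c - ε, 0, t;
        c - ε, s, t, 0] : Matrix (Fin 4) (Fin 4) ℂ).det =
        (σ * t + (c - (2 * r - ε)) * (c - ε) - s ^ 2) ^ 2 + s ^ 2 * (2 * c - 2 * r) ^ 2 := by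
      simp [Matrix.det_succ_row_zero, Fin.sum_univ_succ, Fin.succAbove]
      ring
    rw [hX]
    have h2 : σ * t + (c - (2 * r - ε)) * (c - ε) - s ^ 2 = 2 * c * (c - r) := by
      linear_combination hE - hS
    rw [h2, hS]; ring
  have hiff : (Mtilde θ ε σ).det = 0 ↔ Real.cos θ = ε.re := by
    rw [hdet, Complex.ofReal_eq_zero]
    constructor
    · intro h
      have : (Real.cos θ - ε.re) ^ 2 = 0 := by linarith
      exact sub_eq_zero.mp (pow_eq_zero_iff (two_ne_zero) |>.mp this)
    · intro h; rw [h]; ring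
  rw [hiff]
  have e1 : Complex.exp ((θ : ℂ) * Complex.I) = (Real.cos θ : ℂ) + (Real.sin θ : ℂ) * I := by
    rw [Complex.exp_mul_I]; push_cast; rfl
  have e2 : Complex.exp (-(θ : ℂ) * Complex.I) = (Real.cos θ : ℂ) - (Real.sin θ : ℂ) * I := by
    rw [Complex.exp_mul_I, Complex.cos_neg, Complex.sin_neg]; push_cast; ring
  rw [e1, e2]
  constructor
  · intro h
    have hs : ε.im ^ 2 + Complex.normSq σ = Real.sin θ ^ 2 := by
      rw [Real.sin_sq, h]
      rw [Complex.normSq_apply] at hlam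
      linarith
    rw [hs, Real.sqrt_sq_eq_abs, h]
    rcases abs_choice (Real.sin θ) with h' | h'
    · left; rw [h']; ring
    · right; rw [h']; push_cast; ring
  · rintro (h | h)
    · simpa [-Complex.ofReal_cos, -Complex.ofReal_sin] using congrArg Complex.re h
    · simpa [-Complex.ofReal_cos, -Complex.ofReal_sin] using congrArg Complex.re h
end
end

section
/- Let θ, φ, δ ∈ ℝ with sin θ ≠ 0 and sin φ ≠ 0, and set σ = sin θ · sin φ · e^{iδ}. (1) If ε = cos θ + i·sin θ·cos φ, then the solution set of M̃(θ,ε,σ)·(z₁,z₂,w₁,w₂)ᵀ = 0 in ℂ⁴ is exactly {(z₁, z₂, (e^{iδ}/sin φ)(−z₂ + i z₁ cos φ), (e^{iδ}/sin φ)(z₁ + i z₂ cos φ)) : z₁, z₂ ∈ ℂ}. (2) If ε = cos θ − i·sin θ·cos φ, then the solution set is exactly {(z₁, z₂, (e^{iδ}/sin φ)(−z₂ − i z₁ cos φ), (e^{iδ}/sin φ)(z₁ − i z₂ cos φ)) : z₁, z₂ ∈ ℂ}. -/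
noncomputable section

open Complex

/-- The kernel computation over abstract complex parameters. -/
theorem kernel_aux (s q c e e' z₁ z₂ w₁ w₂ : ℂ) (hs : s ≠ 0) (hq : q ≠ 0)
    (he : e * e' = 1) (h1 : q ^ 2 + c ^ 2 = 1) :
    ((-(s * q * e) * z₂ + -s * w₁ + I * (s * c) * w₂ = 0) ∧
     (-(s * q * e) * z₁ + I * (s * c) * w₁ + s * w₂ = 0) ∧
     (-s * z₁ + -(I * (s * c)) * z₂ + s * q * e' * w₂ = 0) ∧
     (-(I * (s * c)) * z₁ + s * z₂ + s * q * e' * w₁ = 0)) ↔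
    (w₁ = e / q * (-z₂ + I * z₁ * c) ∧ w₂ = e / q * (z₁ + I * z₂ * c)) := by
  have hI : I ^ 2 = -1 := I_sq
  constructor
  · rintro ⟨-, -, h3, h4⟩
    constructor
    · rw [div_mul_eq_mul_div, eq_div_iff hq]
      apply mul_left_cancel₀ hs
      linear_combination e * h4 - s * q * w₁ * he
    · rw [div_mul_eq_mul_div, eq_div_iff hq]
      apply mul_left_cancel₀ hs
      linear_combination e * h3 - s * q * w₂ * he
  · rintro ⟨h3, h4⟩
    rw [div_mul_eq_mul_div, eq_div_iff hq] at h3 h4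
    refine ⟨?_, ?_, ?_, ?_⟩
    · apply mul_left_cancel₀ hq
      linear_combination -s * h3 + I * s * c * h4 + s * e * z₂ * c ^ 2 * hI - s * e * z₂ * h1
    · apply mul_left_cancel₀ hq
      linear_combination I * s * c * h3 + s * h4 + s * e * z₁ * c ^ 2 * hI - s * e * z₁ * h1
    · linear_combination s * e' * h4 + s * (z₁ + I * z₂ * c) * he
    · linear_combination s * e' * h3 + s * (-z₂ + I * z₁ * c) * he

theorem kernel_set (θ δ q c : ℝ) (hθ : Real.sin θ ≠ 0) (hq : q ≠ 0) (h1 : q ^ 2 + c ^ 2 = 1) :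
    {v : Fin 4 → ℂ |
        (Mtilde θ ((Real.cos θ : ℂ) + Complex.I * ((Real.sin θ * c : ℝ) : ℂ))
          (((Real.sin θ * q : ℝ) : ℂ) * Complex.exp ((δ : ℂ) * Complex.I))).mulVec v = 0} =
      {v | ∃ z₁ z₂ : ℂ, v = ![z₁, z₂,
        (Complex.exp ((δ : ℂ) * Complex.I) / (q : ℂ)) * (-z₂ + Complex.I * z₁ * (c : ℂ)),
        (Complex.exp ((δ : ℂ) * Complex.I) / (q : ℂ)) * (z₁ + Complex.I * z₂ * (c : ℂ))]} := by
  have hconj : (starRingEnd ℂ) (exp ((δ : ℂ) * I)) = exp (-((δ : ℂ) * I)) := by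
    rw [← exp_conj]; simp
  have he : exp ((δ : ℂ) * I) * exp (-((δ : ℂ) * I)) = 1 := by
    rw [← exp_add]; simp
  have hs' : ((Real.sin θ : ℝ) : ℂ) ≠ 0 := by exact_mod_cast hθ
  have hq' : (q : ℂ) ≠ 0 := by exact_mod_cast hq
  have h1' : (q : ℂ) ^ 2 + (c : ℂ) ^ 2 = 1 := by exact_mod_cast h1
  ext v
  have key := kernel_aux (Real.sin θ : ℝ) q c _ _ (v 0) (v 1) (v 2) (v 3) hs' hq' he h1'
  have hR : (v ∈ {v : Fin 4 → ℂ | ∃ z₁ z₂ : ℂ, v = ![z₁, z₂,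
        (Complex.exp ((δ : ℂ) * Complex.I) / (q : ℂ)) * (-z₂ + Complex.I * z₁ * (c : ℂ)),
        (Complex.exp ((δ : ℂ) * Complex.I) / (q : ℂ)) * (z₁ + Complex.I * z₂ * (c : ℂ))]}) ↔
      (v 2 = exp ((δ : ℂ) * I) / q * (-v 1 + I * v 0 * c) ∧
        v 3 = exp ((δ : ℂ) * I) / q * (v 0 + I * v 1 * c)) := by
    constructor
    · rintro ⟨z₁, z₂, rfl⟩
      exact ⟨rfl, rfl⟩
    · rintro ⟨h2, h3⟩
      refine ⟨v 0, v 1, ?_⟩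
      funext i
      fin_cases i
      · rfl
      · rfl
      · exact h2
      · exact h3
  rw [hR, ← key, Set.mem_ofPred_eq, funext_iff]
  generalize exp (-((δ : ℂ) * I)) = e' at *
  generalize exp ((δ : ℂ) * I) = e at *
  simp only [Fin.forall_fin_succ, Mtilde, Matrix.mulVec, dotProduct, Fin.sum_univ_four]
  simp [hconj, -ofReal_sin, -ofReal_cos]

/-- Proposition 2.8: with `sin θ ≠ 0`, `sin φ ≠ 0` and
`σ = sin θ sin φ e^{iδ}`, the kernel of `M̃(θ, ε, σ)` for `ε = cos θ ± i sin θ cos φ`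
is the space `Ṽ₁` (resp. `Ṽ₂`) described explicitly below. -/
theorem statement13 (θ φ δ : ℝ) (hθ : Real.sin θ ≠ 0) (hφ : Real.sin φ ≠ 0) :
    ({v : Fin 4 → ℂ |
        (Mtilde θ ((Real.cos θ : ℂ) + Complex.I * ((Real.sin θ * Real.cos φ : ℝ) : ℂ))
          (((Real.sin θ * Real.sin φ : ℝ) : ℂ) *
            Complex.exp ((δ : ℂ) * Complex.I))).mulVec v = 0} =
      {v | ∃ z₁ z₂ : ℂ, v = ![z₁, z₂,
        (Complex.exp ((δ : ℂ) * Complex.I) / ((Real.sin φ : ℝ) : ℂ)) *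
          (-z₂ + Complex.I * z₁ * ((Real.cos φ : ℝ) : ℂ)),
        (Complex.exp ((δ : ℂ) * Complex.I) / ((Real.sin φ : ℝ) : ℂ)) *
          (z₁ + Complex.I * z₂ * ((Real.cos φ : ℝ) : ℂ))]}) ∧
    ({v : Fin 4 → ℂ |
        (Mtilde θ ((Real.cos θ : ℂ) - Complex.I * ((Real.sin θ * Real.cos φ : ℝ) : ℂ))
          (((Real.sin θ * Real.sin φ : ℝ) : ℂ) *
            Complex.exp ((δ : ℂ) * Complex.I))).mulVec v = 0} =
      {v | ∃ z₁ z₂ : ℂ, v = ![z₁, z₂,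
        (Complex.exp ((δ : ℂ) * Complex.I) / ((Real.sin φ : ℝ) : ℂ)) *
          (-z₂ - Complex.I * z₁ * ((Real.cos φ : ℝ) : ℂ)),
        (Complex.exp ((δ : ℂ) * Complex.I) / ((Real.sin φ : ℝ) : ℂ)) *
          (z₁ - Complex.I * z₂ * ((Real.cos φ : ℝ) : ℂ))]}) := by
  refine ⟨kernel_set θ δ _ _ hθ hφ (Real.sin_sq_add_cos_sq φ), ?_⟩
  have h := kernel_set θ δ (Real.sin φ) (-Real.cos φ) hθ hφ
    (by rw [neg_sq]; exact Real.sin_sq_add_cos_sq φ)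
  simpa only [mul_neg, ofReal_neg, ← sub_eq_add_neg] using h
end
end

section
/- Suppose all three 2×2 minors Δ_{αβ} (1 ≤ α < β ≤ 3) of the weight matrix Ω are nonzero. Then no element of N(Ω) has a vanishing quaternionic pair; that is, for every u ∈ N(Ω) and every α ∈ {1,2,3} one has (u_{2α}, u_{2α+1}) ≠ (0,0). -/
open scoped Quaternion
open Finset

noncomputable section

/-- Membership in `N(Ω)`, where the point of `ℍ⁷` is `(u₁, a 0, b 0, a 1, b 1, a 2, b 2)`
and the quaternionic pairs are `(a α, b α) = (u_{2α}, u_{2α+1})` for `α : Fin 3`. -/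
def inNΩ (p q : Fin 3 → ℤ) (u1 : ℍ[ℝ]) (a b : Fin 3 → ℍ[ℝ]) : Prop :=
  (‖u1‖ ^ 2 + ∑ α : Fin 3, (‖a α‖ ^ 2 + ‖b α‖ ^ 2) = 1) ∧
  (∀ e ∈ ({qI, qJ, qK} : Set ℍ[ℝ]),
    star u1 * e * u1 +
      ∑ α : Fin 3, (star (a α) * e * a α + star (b α) * e * b α) = 0) ∧
  (∀ d ∈ ({p, q} : Set (Fin 3 → ℤ)),
    ∑ α : Fin 3, (d α : ℝ) • (star (a α) * b α - star (b α) * a α) = 0)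

/-- The 2×2 minor `Δ_{αβ} = p_α q_β − p_β q_α` of `Ω`. -/
def Δ2 (p q : Fin 3 → ℤ) (α β : Fin 3) : ℤ := p α * q β - p β * q α

/-- Real dot product on quaternions, in coordinates. -/
def dotq (x y : ℍ[ℝ]) : ℝ :=
  x.re * y.re + x.imI * y.imI + x.imJ * y.imJ + x.imK * y.imK

def dotqL (x : ℍ[ℝ]) : ℍ[ℝ] →ₗ[ℝ] ℝ where
  toFun y := dotq x y
  map_add' y z := by simp [dotq]; ring
  map_smul' c y := by simp [dotq]; ring

lemma dotq_exists (x y z : ℍ[ℝ]) :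
    ∃ n : ℍ[ℝ], n ≠ 0 ∧ dotq x n = 0 ∧ dotq y n = 0 ∧ dotq z n = 0 := by
  let f : ℍ[ℝ] →ₗ[ℝ] (Fin 3 → ℝ) := LinearMap.pi ![dotqL x, dotqL y, dotqL z]
  have hf : LinearMap.ker f ≠ ⊥ := by
    apply LinearMap.ker_ne_bot_of_finrank_lt
    rw [Quaternion.finrank_eq_four]; simp
  obtain ⟨n, hn, hn0⟩ := (Submodule.ne_bot_iff _).1 hf
  have h : f n = 0 := hn
  refine ⟨n, hn0, ?_, ?_, ?_⟩
  · exact congrFun h 0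
  · exact congrFun h 1
  · exact congrFun h 2

lemma qJ_re : qJ.re = 0 := rfl
lemma qJ_imI : qJ.imI = 0 := rfl
lemma qJ_imJ : qJ.imJ = 1 := rfl
lemma qJ_imK : qJ.imK = 0 := rfl
lemma qK_re : qK.re = 0 := rfl
lemma qK_imI : qK.imI = 0 := rfl
lemma qK_imJ : qK.imJ = 0 := rfl
lemma qK_imK : qK.imK = 1 := rfl

/-- The key identity: the traceless part of `u uᵀ` is encoded by `ū e u`. -/
lemma dotq_key (n u : ℍ[ℝ]) :
    4 * dotq u n ^ 2 = dotq n n * ‖u‖ ^ 2 + (dotqL (star n * qI * n) (star u * qI * u)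
      + dotqL (star n * qJ * n) (star u * qJ * u) + dotqL (star n * qK * n) (star u * qK * u)) := by
  have : ‖u‖ ^ 2 = u.re ^ 2 + u.imI ^ 2 + u.imJ ^ 2 + u.imK ^ 2 := by
    rw [sq, ← Quaternion.normSq_eq_norm_mul_self, Quaternion.normSq_def']
  rw [this]
  have eI : ∀ v : ℍ[ℝ], star v * qI * v = ⟨0, v.re ^ 2 + v.imI ^ 2 - v.imJ ^ 2 - v.imK ^ 2,
      2 * (v.imI * v.imJ - v.re * v.imK), 2 * (v.imI * v.imK + v.re * v.imJ)⟩ := by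
    intro v; ext <;> simp [qI_re, qI_imI, qI_imJ, qI_imK] <;> ring
  have eJ : ∀ v : ℍ[ℝ], star v * qJ * v = ⟨0, 2 * (v.imI * v.imJ + v.re * v.imK),
      v.re ^ 2 - v.imI ^ 2 + v.imJ ^ 2 - v.imK ^ 2, 2 * (v.imJ * v.imK - v.re * v.imI)⟩ := by
    intro v; ext <;> simp [qJ_re, qJ_imI, qJ_imJ, qJ_imK] <;> ring
  have eK : ∀ v : ℍ[ℝ], star v * qK * v = ⟨0, 2 * (v.imI * v.imK - v.re * v.imJ),
      2 * (v.imJ * v.imK + v.re * v.imI), v.re ^ 2 - v.imI ^ 2 - v.imJ ^ 2 + v.imK ^ 2⟩ := by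
    intro v; ext <;> simp [qK_re, qK_imI, qK_imJ, qK_imK] <;> ring
  simp only [eI, eJ, eK, dotqL, dotq, LinearMap.coe_mk, AddHom.coe_mk]
  ring

/-- If `ā b` is real then `a`, `b` are real multiples of one quaternion. -/
lemma pair_dep (a b : ℍ[ℝ]) (h : star a * b - star b * a = 0) :
    ∃ x : ℍ[ℝ], ∀ n, dotq x n = 0 → dotq a n = 0 ∧ dotq b n = 0 := by
  by_cases ha : a = 0
  · exact ⟨b, fun n hn => ⟨by simp [ha, dotq], hn⟩⟩
  · refine ⟨a, fun n hn => ⟨hn, ?_⟩⟩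
    have h' : star a * b = star (star a * b) := by simpa using sub_eq_zero.1 h
    obtain ⟨r, hr⟩ : ∃ r : ℝ, star a * b = r := ⟨_, Quaternion.star_eq_self.1 h'.symm⟩
    have h2 : (Quaternion.normSq a) • b = r • a := by
      have : a * (star a * b) = a * r := by rw [hr]
      rw [← mul_assoc, Quaternion.self_mul_star, Quaternion.coe_mul_eq_smul,
        Quaternion.mul_coe_eq_smul] at this
      exact this
    have h3 : Quaternion.normSq a * dotq b n = r * dotq a n := by
      have := congrArg (fun t => dotqL n t) h2
      simp only [map_smul, smul_eq_mul] at this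
      have c : ∀ t, dotqL n t = dotq t n := fun t => by simp [dotqL, dotq]; ring
      simpa only [c] using this
    rw [hn, mul_zero] at h3
    exact (mul_eq_zero.1 h3).resolve_left (by simpa using ha)

lemma contra (u1 : ℍ[ℝ]) (a b : Fin 3 → ℍ[ℝ])
    (h1 : ‖u1‖ ^ 2 + ∑ α : Fin 3, (‖a α‖ ^ 2 + ‖b α‖ ^ 2) = 1)
    (h2 : ∀ e ∈ ({qI, qJ, qK} : Set ℍ[ℝ]),
      star u1 * e * u1 +
        ∑ α : Fin 3, (star (a α) * e * a α + star (b α) * e * b α) = 0)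
    (n : ℍ[ℝ]) (hn : n ≠ 0) (hu : dotq u1 n = 0)
    (hab : ∀ α, dotq (a α) n = 0 ∧ dotq (b α) n = 0) : False := by
  have eI := congrArg (dotqL (star n * qI * n)) (h2 qI (by simp))
  have eJ := congrArg (dotqL (star n * qJ * n)) (h2 qJ (by simp))
  have eK := congrArg (dotqL (star n * qK * n)) (h2 qK (by simp))
  simp only [Fin.sum_univ_three, map_add, map_zero] at eI eJ eK h1
  have k := dotq_key n u1
  have ka := fun α => dotq_key n (a α)
  have kb := fun α => dotq_key n (b α)
  simp only [hu, (hab _).1, (hab _).2] at k ka kb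
  have h0 : dotq n n = 0 := by
    linear_combination -(dotq n n) * h1 - eI - eJ - eK - k - ka 0 - ka 1 - ka 2
      - kb 0 - kb 1 - kb 2
  apply hn
  have : Quaternion.normSq n = 0 := by
    have h9 : Quaternion.normSq n = dotq n n := by
      rw [Quaternion.normSq_def', dotq]; ring
    rw [h9, h0]
  simpa using this

lemma cramer (p1 q1 p2 q2 : ℤ) (h : p1 * q2 - p2 * q1 ≠ 0) (x y : ℍ[ℝ])
    (hp : (p1 : ℝ) • x + (p2 : ℝ) • y = 0) (hq : (q1 : ℝ) • x + (q2 : ℝ) • y = 0) :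
    x = 0 ∧ y = 0 := by
  have h' : (p1 * q2 - p2 * q1 : ℝ) ≠ 0 := by exact_mod_cast h
  constructor
  · refine (smul_eq_zero.1 (?_ : (p1 * q2 - p2 * q1 : ℝ) • x = 0)).resolve_left h'
    linear_combination (norm := module) (q2 : ℝ) • hp - (p2 : ℝ) • hq
  · refine (smul_eq_zero.1 (?_ : (p1 * q2 - p2 * q1 : ℝ) • y = 0)).resolve_left h'
    linear_combination (norm := module) (p1 : ℝ) • hq - (q1 : ℝ) • hp

/-- Lemma 3.1: if all three minors `Δ_{αβ}` of `Ω` are nonzero, then no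
element of `N(Ω)` has a vanishing quaternionic pair. -/
theorem statement14 (p q : Fin 3 → ℤ)
    (hΔ : ∀ α β : Fin 3, α < β → Δ2 p q α β ≠ 0)
    (u1 : ℍ[ℝ]) (a b : Fin 3 → ℍ[ℝ]) (hu : inNΩ p q u1 a b) :
    ∀ α : Fin 3, (a α, b α) ≠ (0, 0) := by
  obtain ⟨h1, h2, h3⟩ := hu
  have hp := h3 p (by simp)
  have hq := h3 q (by simp)
  simp only [Fin.sum_univ_three] at hp hq
  intro α hα
  obtain ⟨ha, hb⟩ := Prod.mk.inj hα
  have D01 := hΔ 0 1 (by decide)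
  have D02 := hΔ 0 2 (by decide)
  have D12 := hΔ 1 2 (by decide)
  have fin : ∀ β γ : Fin 3, (∀ δ, δ = α ∨ δ = β ∨ δ = γ) →
      (star (a β) * b β - star (b β) * a β = 0 ∧
        star (a γ) * b γ - star (b γ) * a γ = 0) → False := by
    rintro β γ hc ⟨hβ, hγ⟩
    obtain ⟨x, hx⟩ := pair_dep _ _ hβ
    obtain ⟨y, hy⟩ := pair_dep _ _ hγ
    obtain ⟨n, hn, hn1, hnx, hny⟩ := dotq_exists u1 x y
    refine contra u1 a b h1 h2 n hn hn1 fun δ => ?_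
    rcases hc δ with rfl | rfl | rfl
    · simp [ha, hb, dotq]
    · exact hx n hnx
    · exact hy n hny
  fin_cases α
  · simp only [Fin.zero_eta] at ha hb
    exact fin 1 2 (by decide) (cramer _ _ _ _ D12 _ _ (by simpa [ha, hb] using hp)
      (by simpa [ha, hb] using hq))
  · simp only [Fin.mk_one] at ha hb
    exact fin 0 2 (by decide) (cramer _ _ _ _ D02 _ _ (by simpa [ha, hb] using hp)
      (by simpa [ha, hb] using hq))
  · simp only [Fin.reduceFinMk] at ha hb
    exact fin 0 1 (by decide) (cramer _ _ _ _ D01 _ _ (by simpa [ha, hb] using hp)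
      (by simpa [ha, hb] using hq))
end
end

section
/- Let Ω ∈ M_{2×3}(ℤ) with rows p, q and all minors Δ_{αβ} nonzero, and let T = {(t,s) ∈ [0,2π)² : p_α t + q_α s ∈ 2πℤ for α = 1,2,3}. Then: (1) for every u ∈ N(Ω) with u₁ ≠ 0, the stabilizer of u under the action (λ, t, s)·u = (rotation of each quaternionic pair (u_{2α}, u_{2α+1}) by angle p_α t + q_α s applied to (λu_{2α}, λu_{2α+1}), and u₁ ↦ λu₁) equals {1} × T, and this set is finite; (2) T = {(0,0)} if and only if gcd(Δ₁₂, Δ₁₃, Δ₂₃) = 1; hence the action of Sp(1) × T²_Ω on S₁ = N(Ω) ∩ {u₁ ≠ 0} is free if and only if gcd(Δ₁₂, Δ₁₃, Δ₂₃) = ±1. -/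
open scoped Quaternion
open Finset

noncomputable section

/-- The subgroup `T ⊆ [0,2π)²` of torus parameters solving the congruences
`p_α t + q_α s ∈ 2πℤ` for `α = 1, 2, 3`. -/
def Tset (p q : Fin 3 → ℤ) : Set (ℝ × ℝ) :=
  {ts | ts.1 ∈ Set.Ico 0 (2 * Real.pi) ∧ ts.2 ∈ Set.Ico 0 (2 * Real.pi) ∧
    ∀ α : Fin 3, ∃ k : ℤ, (p α : ℝ) * ts.1 + (q α : ℝ) * ts.2 = 2 * Real.pi * k}

/-- The stabilizer of the point `(u₁, a, b)` under the `Sp(1) × T²_Ω` action: `(λ, t, s)`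
with `λ` a unit quaternion and `(t,s) ∈ [0,2π)²` which fix `u₁` and each quaternionic
pair, the pair `(a α, b α)` being first multiplied by `λ` and then rotated by the angle
`ω_α = p_α t + q_α s`. -/
def StabΩ (p q : Fin 3 → ℤ) (u1 : ℍ[ℝ]) (a b : Fin 3 → ℍ[ℝ]) : Set (ℍ[ℝ] × ℝ × ℝ) :=
  {x | ‖x.1‖ = 1 ∧ x.2.1 ∈ Set.Ico 0 (2 * Real.pi) ∧ x.2.2 ∈ Set.Ico 0 (2 * Real.pi) ∧
    x.1 * u1 = u1 ∧
    ∀ α : Fin 3,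
      Real.cos ((p α : ℝ) * x.2.1 + (q α : ℝ) * x.2.2) • (x.1 * a α) +
          Real.sin ((p α : ℝ) * x.2.1 + (q α : ℝ) * x.2.2) • (x.1 * b α) = a α ∧
      (-Real.sin ((p α : ℝ) * x.2.1 + (q α : ℝ) * x.2.2)) • (x.1 * a α) +
          Real.cos ((p α : ℝ) * x.2.1 + (q α : ℝ) * x.2.2) • (x.1 * b α) = b α}

/-- Coordinates of the frame identity: `4 ∑ ⟨x, u⟩² = |x|²` for points of `N(Ω)`. -/
lemma frame_identity (p q : Fin 3 → ℤ) (u : ℍ[ℝ]) (a b : Fin 3 → ℍ[ℝ]) (h : inNΩ p q u a b)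
    (x0 x1 x2 x3 : ℝ) :
    4 * ((x0 * u.re + x1 * u.imI + x2 * u.imJ + x3 * u.imK) ^ 2 +
      ∑ α : Fin 3, ((x0 * (a α).re + x1 * (a α).imI + x2 * (a α).imJ + x3 * (a α).imK) ^ 2 +
        (x0 * (b α).re + x1 * (b α).imI + x2 * (b α).imJ + x3 * (b α).imK) ^ 2)) =
    x0 ^ 2 + x1 ^ 2 + x2 ^ 2 + x3 ^ 2 := by
  obtain ⟨h1, h2, -⟩ := h
  have hI := h2 qI (by simp)
  have hJ := h2 qJ (by simp)
  have hK := h2 qK (by simp)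
  simp only [pow_two, ← Quaternion.normSq_eq_norm_mul_self, Fin.sum_univ_three] at h1
  simp only [Quaternion.normSq_def'] at h1
  simp only [Fin.sum_univ_three, Quaternion.ext_iff] at hI hJ hK
  simp [qI_re, qI_imI, qI_imJ, qI_imK] at hI
  simp [qJ_re, qJ_imI, qJ_imJ, qJ_imK] at hJ
  simp [qK_re, qK_imI, qK_imJ, qK_imK] at hK
  obtain ⟨-, a1, a2, a3⟩ := hI
  obtain ⟨-, b1, b2, b3⟩ := hJ
  obtain ⟨-, c1, c2, c3⟩ := hK
  simp only [Fin.sum_univ_three]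
  linear_combination (x0 ^ 2 + x1 ^ 2 + x2 ^ 2 + x3 ^ 2) * h1
    + (x0 ^ 2 + x1 ^ 2 - x2 ^ 2 - x3 ^ 2) * a1
    + (x0 ^ 2 - x1 ^ 2 + x2 ^ 2 - x3 ^ 2) * b2
    + (x0 ^ 2 - x1 ^ 2 - x2 ^ 2 + x3 ^ 2) * c3
    + (2 * x1 * x2 - 2 * x0 * x3) * a2 + (2 * x1 * x2 + 2 * x0 * x3) * b1
    + (2 * x1 * x3 + 2 * x0 * x2) * a3 + (2 * x1 * x3 - 2 * x0 * x2) * c1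
    + (2 * x2 * x3 - 2 * x0 * x1) * b3 + (2 * x2 * x3 + 2 * x0 * x1) * c2

/-- If `Im (ā b) = 0` then `a` and `b` are real-parallel. -/
lemma parallel_of_comm (a b : ℍ[ℝ]) (h : star a * b - star b * a = 0) :
    (a.re * b.re + a.imI * b.imI + a.imJ * b.imJ + a.imK * b.imK) ^ 2 =
      Quaternion.normSq a * Quaternion.normSq b := by
  rw [Quaternion.ext_iff] at h
  simp at h
  obtain ⟨-, h1, h2, h3⟩ := h
  rw [Quaternion.normSq_def', Quaternion.normSq_def']
  have e1 : a.re * b.imI - a.imI * b.re - a.imJ * b.imK + a.imK * b.imJ = 0 := by linarith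
  have e2 : a.re * b.imJ - a.imJ * b.re - a.imK * b.imI + a.imI * b.imK = 0 := by linarith
  have e3 : a.re * b.imK - a.imK * b.re - a.imI * b.imJ + a.imJ * b.imI = 0 := by linarith
  linear_combination
    -(a.re * b.imI - a.imI * b.re - a.imJ * b.imK + a.imK * b.imJ) * e1
    - (a.re * b.imJ - a.imJ * b.re - a.imK * b.imI + a.imI * b.imK) * e2
    - (a.re * b.imK - a.imK * b.re - a.imI * b.imJ + a.imJ * b.imI) * e3

/-- Weight bound for a parallel pair. -/
lemma pair_bound (p q : Fin 3 → ℤ) (u : ℍ[ℝ]) (a b : Fin 3 → ℍ[ℝ]) (h : inNΩ p q u a b)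
    (α : Fin 3) (hp : star (a α) * b α - star (b α) * a α = 0) :
    Quaternion.normSq (a α) + Quaternion.normSq (b α) ≤ 1 / 4 := by
  have hpar := parallel_of_comm _ _ hp
  have key : ∀ x : ℍ[ℝ],
      4 * ((x.re * (a α).re + x.imI * (a α).imI + x.imJ * (a α).imJ + x.imK * (a α).imK) ^ 2 +
        (x.re * (b α).re + x.imI * (b α).imI + x.imJ * (b α).imJ + x.imK * (b α).imK) ^ 2) ≤
      Quaternion.normSq x := by
    intro x
    rw [Quaternion.normSq_def', ← frame_identity p q u a b h x.re x.imI x.imJ x.imK]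
    have := Finset.single_le_sum (s := Finset.univ)
      (f := fun α : Fin 3 =>
        (x.re * (a α).re + x.imI * (a α).imI + x.imJ * (a α).imJ + x.imK * (a α).imK) ^ 2 +
        (x.re * (b α).re + x.imI * (b α).imI + x.imJ * (b α).imJ + x.imK * (b α).imK) ^ 2)
      (fun i _ => by positivity) (Finset.mem_univ α)
    have h0 := sq_nonneg (x.re * u.re + x.imI * u.imI + x.imJ * u.imJ + x.imK * u.imK)
    linarith
  have ka := key (a α)
  have kb := key (b α)
  have ea : (a α).re * (a α).re + (a α).imI * (a α).imI + (a α).imJ * (a α).imJ +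
      (a α).imK * (a α).imK = Quaternion.normSq (a α) := by
    rw [Quaternion.normSq_def']; ring
  have eb : (b α).re * (b α).re + (b α).imI * (b α).imI + (b α).imJ * (b α).imJ +
      (b α).imK * (b α).imK = Quaternion.normSq (b α) := by
    rw [Quaternion.normSq_def']; ring
  have hpar' : ((b α).re * (a α).re + (b α).imI * (a α).imI + (b α).imJ * (a α).imJ +
      (b α).imK * (a α).imK) ^ 2 = Quaternion.normSq (a α) * Quaternion.normSq (b α) := by
    rw [← hpar]; ring
  rw [ea, hpar] at ka
  rw [eb, hpar'] at kb
  have na : 0 ≤ Quaternion.normSq (a α) := Quaternion.normSq_nonneg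
  have nb : 0 ≤ Quaternion.normSq (b α) := Quaternion.normSq_nonneg
  by_contra hc
  push Not at hc
  nlinarith

/-- Weight bound for the first coordinate. -/
lemma first_bound (p q : Fin 3 → ℤ) (u : ℍ[ℝ]) (a b : Fin 3 → ℍ[ℝ]) (h : inNΩ p q u a b) :
    Quaternion.normSq u ≤ 1 / 4 := by
  have key := frame_identity p q u a b h u.re u.imI u.imJ u.imK
  have hs : 0 ≤ ∑ α : Fin 3,
    ((u.re * (a α).re + u.imI * (a α).imI + u.imJ * (a α).imJ + u.imK * (a α).imK) ^ 2 +
        (u.re * (b α).re + u.imI * (b α).imI + u.imJ * (b α).imJ + u.imK * (b α).imK) ^ 2) :=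
    Finset.sum_nonneg (fun i _ => by positivity)
  have eu : u.re * u.re + u.imI * u.imI + u.imJ * u.imJ + u.imK * u.imK
      = Quaternion.normSq u := by
    rw [Quaternion.normSq_def']; ring
  rw [eu, ← Quaternion.normSq_def'] at key
  have nu : 0 ≤ Quaternion.normSq u := Quaternion.normSq_nonneg
  by_contra hc
  push Not at hc
  nlinarith

/-- Two-by-two cancellation. -/
lemma solve_two (x y x' y' : ℤ) (hd : x * y' - y * x' ≠ 0) (v w : ℍ[ℝ])
    (h1 : (x : ℝ) • v + (y : ℝ) • w = 0) (h2 : (x' : ℝ) • v + (y' : ℝ) • w = 0) :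
    v = 0 ∧ w = 0 := by
  have hd' : ((x : ℝ) * y' - y * x') ≠ 0 := by exact_mod_cast hd
  constructor
  · have : ((x : ℝ) * y' - y * x') • v = 0 := by
      have e : ((x : ℝ) * y' - y * x') • v = (y' : ℝ) • ((x : ℝ) • v + (y : ℝ) • w)
        - (y : ℝ) • ((x' : ℝ) • v + (y' : ℝ) • w) := by module
      rw [e, h1, h2]; simp
    exact (smul_eq_zero.mp this).resolve_left hd'
  · have : ((x : ℝ) * y' - y * x') • w = 0 := by
      have e : ((x : ℝ) * y' - y * x') • w = (x : ℝ) • ((x' : ℝ) • v + (y' : ℝ) • w)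
        - (x' : ℝ) • ((x : ℝ) • v + (y : ℝ) • w) := by module
      rw [e, h1, h2]; simp
    exact (smul_eq_zero.mp this).resolve_left hd'

lemma pair_ne_zero (p q : Fin 3 → ℤ) (hΔ : ∀ α β : Fin 3, α < β → Δ2 p q α β ≠ 0)
    (u : ℍ[ℝ]) (a b : Fin 3 → ℍ[ℝ]) (h : inNΩ p q u a b)
    (α : Fin 3) : ¬ (a α = 0 ∧ b α = 0) := by
  rintro ⟨ha, hb⟩
  have hu := first_bound p q u a b h
  have hpb := pair_bound p q u a b h
  have h01 := hΔ 0 1 (by decide)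
  have h02 := hΔ 0 2 (by decide)
  have h12 := hΔ 1 2 (by decide)
  obtain ⟨h1, -, h3⟩ := h
  have hp := h3 p (by simp)
  have hq := h3 q (by simp)
  simp only [Fin.sum_univ_three] at hp hq
  simp only [pow_two, ← Quaternion.normSq_eq_norm_mul_self, Fin.sum_univ_three] at h1
  unfold Δ2 at h01 h02 h12
  fin_cases α <;> simp only [Fin.zero_eta, Fin.mk_one, Fin.reduceFinMk] at ha hb <;>
    simp [ha, hb] at hp hq h1
  · obtain ⟨e1, e2⟩ := solve_two _ _ _ _ h12 _ _ hp hq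
    linarith [hpb 1 e1, hpb 2 e2]
  · obtain ⟨e1, e2⟩ := solve_two _ _ _ _ h02 _ _ hp hq
    linarith [hpb 0 e1, hpb 2 e2]
  · obtain ⟨e1, e2⟩ := solve_two _ _ _ _ h01 _ _ hp hq
    linarith [hpb 0 e1, hpb 1 e2]

/-- A rotation that fixes a nonzero pair has trivial cosine. -/
lemma cos_eq_one_of_fix (c s : ℝ) (hcs : s ^ 2 + c ^ 2 = 1) (a b : ℍ[ℝ])
    (hab : ¬ (a = 0 ∧ b = 0))
    (h1 : c • a + s • b = a) (h2 : (-s) • a + c • b = b) : c = 1 := by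
  by_contra hc
  have hne : 2 - 2 * c ≠ 0 := fun h => hc (by linarith)
  have h1' : (c - 1) • a + s • b = 0 := by
    rw [sub_smul, one_smul, sub_add_eq_add_sub, h1, sub_self]
  have h2' : (-s) • a + (c - 1) • b = 0 := by
    rw [sub_smul, one_smul, ← add_sub_assoc, h2, sub_self]
  have hd : (c - 1) * (c - 1) + s * s = 2 - 2 * c := by linear_combination hcs
  apply hab
  constructor
  · have e : (2 - 2 * c) • a = (c - 1) • ((c - 1) • a + s • b) - s • ((-s) • a + (c - 1) • b) := by
      rw [← hd]; module
    rw [h1', h2'] at e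
    simp only [smul_zero, sub_self] at e
    exact (smul_eq_zero.mp e).resolve_left hne
  · have e : (2 - 2 * c) • b = s • ((c - 1) • a + s • b) + (c - 1) • ((-s) • a + (c - 1) • b) := by
      rw [← hd]; module
    rw [h1', h2'] at e
    simp only [smul_zero, add_zero] at e
    exact (smul_eq_zero.mp e).resolve_left hne

lemma stab_eq (p q : Fin 3 → ℤ) (hΔ : ∀ α β : Fin 3, α < β → Δ2 p q α β ≠ 0)
    (u : ℍ[ℝ]) (a b : Fin 3 → ℍ[ℝ]) (h : inNΩ p q u a b) (hu : u ≠ 0) :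
    StabΩ p q u a b = {x : ℍ[ℝ] × ℝ × ℝ | x.1 = 1 ∧ x.2 ∈ Tset p q} := by
  ext ⟨l, t, s⟩
  simp only [StabΩ, Tset, Set.mem_ofPred_eq]
  constructor
  · rintro ⟨-, ht, hs, hl, hfix⟩
    have hl1 : l = 1 := mul_right_cancel₀ hu (by rw [hl, one_mul])
    subst hl1
    refine ⟨rfl, ht, hs, fun α => ?_⟩
    obtain ⟨f1, f2⟩ := hfix α
    simp only [one_mul] at f1 f2
    have hc := cos_eq_one_of_fix _ _ (Real.sin_sq_add_cos_sq _) _ _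
      (pair_ne_zero p q hΔ u a b h α) f1 f2
    obtain ⟨k, hk⟩ := (Real.cos_eq_one_iff _).mp hc
    exact ⟨k, by rw [← hk]; ring⟩
  · rintro ⟨rfl, ht, hs, hk⟩
    refine ⟨by simp, ht, hs, by simp, fun α => ?_⟩
    obtain ⟨k, hk⟩ := hk α
    have hc : Real.cos ((p α : ℝ) * t + q α * s) = 1 :=
      (Real.cos_eq_one_iff _).mpr ⟨k, by rw [hk]; ring⟩
    have hs : Real.sin ((p α : ℝ) * t + q α * s) = 0 := by
      have := Real.sin_sq_add_cos_sq ((p α : ℝ) * t + q α * s)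
      rw [hc] at this
      nlinarith
    rw [hc, hs]
    simp

/-- Cramer's rule for elements of `T`. -/
lemma cramer_T (p q : Fin 3 → ℤ) (ts : ℝ × ℝ) (h : ts ∈ Tset p q) (α β : Fin 3) :
    (∃ m : ℤ, (Δ2 p q α β : ℝ) * ts.1 = 2 * Real.pi * m) ∧
    (∃ m : ℤ, (Δ2 p q α β : ℝ) * ts.2 = 2 * Real.pi * m) := by
  obtain ⟨-, -, h⟩ := h
  obtain ⟨k, hk⟩ := h α
  obtain ⟨l, hl⟩ := h β
  refine ⟨⟨k * q β - l * q α, ?_⟩, ⟨l * p α - k * p β, ?_⟩⟩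
  · unfold Δ2; push_cast
    linear_combination (q β : ℝ) * hk - (q α : ℝ) * hl
  · unfold Δ2; push_cast
    linear_combination (p α : ℝ) * hl - (p β : ℝ) * hk

lemma bound_aux (D m : ℤ) (t : ℝ) (ht : t ∈ Set.Ico 0 (2 * Real.pi))
    (h : (D : ℝ) * t = 2 * Real.pi * m) : m ∈ Set.Icc (-|D|) |D| := by
  have hpi : 0 < 2 * Real.pi := by positivity
  have h1 : |(D : ℝ)| * |t| = 2 * Real.pi * |(m : ℝ)| := by
    rw [← abs_mul, h, abs_mul, abs_of_pos hpi]
  have h2 : |t| ≤ 2 * Real.pi := by rw [abs_of_nonneg ht.1]; exact ht.2.le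
  have h3 : 2 * Real.pi * |(m : ℝ)| ≤ 2 * Real.pi * |(D : ℝ)| := by
    rw [← h1, mul_comm]; exact mul_le_mul_of_nonneg_right h2 (abs_nonneg _)
  have h4 : |(m : ℝ)| ≤ |(D : ℝ)| := le_of_mul_le_mul_left h3 hpi
  have h5 : |m| ≤ |D| := by exact_mod_cast h4
  exact abs_le.mp h5

lemma T_finite (p q : Fin 3 → ℤ) (h01 : Δ2 p q 0 1 ≠ 0) : (Tset p q).Finite := by
  set D := Δ2 p q 0 1 with hD
  have hfin : ((fun m : ℤ × ℤ => ((2 * Real.pi * m.1 / D : ℝ), (2 * Real.pi * m.2 / D : ℝ))) ''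
      (Set.Icc (-|D|) |D| ×ˢ Set.Icc (-|D|) |D|)).Finite :=
    ((Set.finite_Icc _ _).prod (Set.finite_Icc _ _)).image _
  refine hfin.subset ?_
  rintro ts hts
  obtain ⟨⟨m, hm⟩, ⟨n, hn⟩⟩ := cramer_T p q ts hts 0 1
  rw [← hD] at hm hn
  have hD0 : (D : ℝ) ≠ 0 := by exact_mod_cast h01
  refine ⟨(m, n), ⟨bound_aux D m _ hts.1 hm, bound_aux D n _ hts.2.1 hn⟩, ?_⟩
  ext
  · simp only; rw [← hm]; field_simp
  · simp only; rw [← hn]; field_simp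

lemma zero_of_gcd (x y z : ℤ) (hg : Int.gcd (Int.gcd x y) z = 1) (t : ℝ)
    (ht : t ∈ Set.Ico 0 (2 * Real.pi))
    (hx : ∃ m : ℤ, (x : ℝ) * t = 2 * Real.pi * m) (hy : ∃ m : ℤ, (y : ℝ) * t = 2 * Real.pi * m)
    (hz : ∃ m : ℤ, (z : ℝ) * t = 2 * Real.pi * m) : t = 0 := by
  obtain ⟨k, hk⟩ := hx
  obtain ⟨l, hl⟩ := hy
  obtain ⟨m, hm⟩ := hz
  have b1 := Int.gcd_eq_gcd_ab x y
  have b2 := Int.gcd_eq_gcd_ab (Int.gcd x y) z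
  rw [hg, b1] at b2
  set A := Int.gcdA x y
  set B := Int.gcdB x y
  set C := Int.gcdA (x * A + y * B) z
  set E := Int.gcdB (x * A + y * B) z
  have b3 : (1 : ℝ) = (x * A + y * B) * C + z * E := by exact_mod_cast b2
  have ht2 : t = 2 * Real.pi * ((k * A * C + l * B * C + m * E : ℤ) : ℝ) := by
    push_cast
    linear_combination t * b3 + (A * C : ℝ) * hk + (B * C : ℝ) * hl + (E : ℝ) * hm
  set N := k * A * C + l * B * C + m * E
  have hpi : 0 < 2 * Real.pi := by positivity
  have n1 : (0 : ℝ) ≤ N := by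
    by_contra hc
    push Not at hc
    have := ht.1
    nlinarith
  have n2 : (N : ℝ) < 1 := by
    by_contra hc
    push Not at hc
    have := ht.2
    nlinarith
  have n3 : N = 0 := by
    have a1 : 0 ≤ N := by exact_mod_cast n1
    have a2 : N < 1 := by exact_mod_cast n2
    omega
  rw [ht2, n3]; simp

lemma zero_mem_T (p q : Fin 3 → ℤ) : ((0 : ℝ), (0 : ℝ)) ∈ Tset p q := by
  have hpi : 0 < 2 * Real.pi := by positivity
  exact ⟨⟨le_refl _, hpi⟩, ⟨le_refl _, hpi⟩, fun α => ⟨0, by simp⟩⟩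

/-- A mod-`l` solution of the congruences gives an element of `T`. -/
lemma mem_T_of_mod (p q : Fin 3 → ℤ) (l : ℤ) (hl : 0 < l) (m n : ℤ)
    (h : ∀ α, l ∣ p α * m + q α * n) :
    ((2 * Real.pi * ((m % l : ℤ) : ℝ) / l : ℝ), (2 * Real.pi * ((n % l : ℤ) : ℝ) / l : ℝ))
      ∈ Tset p q := by
  have hpi : 0 < 2 * Real.pi := by positivity
  have hlr : (0 : ℝ) < l := by exact_mod_cast hl
  have hmem : ∀ m : ℤ, (2 * Real.pi * ((m % l : ℤ) : ℝ) / l : ℝ) ∈ Set.Ico 0 (2 * Real.pi) := by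
    intro m
    have h1 : (0 : ℝ) ≤ ((m % l : ℤ) : ℝ) := by exact_mod_cast Int.emod_nonneg _ hl.ne'
    have h2 : ((m % l : ℤ) : ℝ) < l := by exact_mod_cast Int.emod_lt_of_pos _ hl
    refine ⟨by positivity, ?_⟩
    rw [div_lt_iff₀ hlr]
    exact mul_lt_mul_of_pos_left h2 hpi
  refine ⟨hmem m, hmem n, fun α => ?_⟩
  have hd : l ∣ p α * (m % l) + q α * (n % l) := by
    have e : p α * (m % l) + q α * (n % l) =
        p α * m + q α * n - l * (p α * (m / l) + q α * (n / l)) := by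
      rw [Int.emod_def, Int.emod_def]; ring
    rw [e]
    exact dvd_sub (h α) (dvd_mul_right _ _)
  obtain ⟨k, hk⟩ := hd
  refine ⟨k, ?_⟩
  have hk' : (p α : ℝ) * ((m % l : ℤ) : ℝ) + q α * ((n % l : ℤ) : ℝ) = l * k := by
    exact_mod_cast hk
  simp only
  field_simp
  linear_combination hk'

lemma T_trivial_iff (p q : Fin 3 → ℤ) :
    Tset p q = {((0 : ℝ), (0 : ℝ))} ↔
      Int.gcd (Int.gcd (Δ2 p q 0 1) (Δ2 p q 0 2)) (Δ2 p q 1 2) = 1 := by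
  constructor
  · intro hT
    by_contra hg
    obtain ⟨l, hl, hdvd⟩ := Nat.exists_prime_and_dvd hg
    have hd : (l : ℤ) ∣ (Int.gcd (Int.gcd (Δ2 p q 0 1) (Δ2 p q 0 2)) (Δ2 p q 1 2) : ℤ) :=
      Int.natCast_dvd_natCast.mpr hdvd
    have d12 : (l : ℤ) ∣ Δ2 p q 1 2 := hd.trans (Int.gcd_dvd_right _ _)
    have dd : (l : ℤ) ∣ (Int.gcd (Δ2 p q 0 1) (Δ2 p q 0 2) : ℤ) := hd.trans (Int.gcd_dvd_left _ _)
    have d01 : (l : ℤ) ∣ Δ2 p q 0 1 := dd.trans (Int.gcd_dvd_left _ _)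
    have d02 : (l : ℤ) ∣ Δ2 p q 0 2 := dd.trans (Int.gcd_dvd_right _ _)
    have hl0 : (0 : ℤ) < l := by exact_mod_cast hl.pos
    have hpi : 0 < 2 * Real.pi := by positivity
    -- every mod-l solution is trivial
    have triv : ∀ m n : ℤ, (∀ α, (l : ℤ) ∣ p α * m + q α * n) → (l : ℤ) ∣ m ∧ (l : ℤ) ∣ n := by
      intro m n h
      have hm := mem_T_of_mod p q l hl0 m n h
      rw [hT, Set.mem_singleton_iff, Prod.mk.injEq] at hm
      have hlr : ((l : ℤ) : ℝ) ≠ 0 := by exact_mod_cast hl0.ne'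
      have aux : ∀ m : ℤ, (2 * Real.pi * ((m % l : ℤ) : ℝ) / ((l : ℤ) : ℝ) : ℝ) = 0 →
          (l : ℤ) ∣ m := by
        intro m hm
        rw [div_eq_zero_iff, or_iff_left hlr, mul_eq_zero, or_iff_right hpi.ne'] at hm
        exact Int.dvd_of_emod_eq_zero (by exact_mod_cast hm)
      exact ⟨aux m hm.1, aux n hm.2⟩
    have hall : ∀ α β, (l : ℤ) ∣ Δ2 p q α β := by
      have anti : ∀ α β, Δ2 p q α β = - Δ2 p q β α := by intro α β; unfold Δ2; ring
      have self : ∀ α, Δ2 p q α α = 0 := by intro α; unfold Δ2; ring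
      intro α β
      fin_cases α <;> fin_cases β <;>
        simp only [Fin.zero_eta, Fin.mk_one, Fin.reduceFinMk]
      · rw [self]; exact dvd_zero _
      · exact d01
      · exact d02
      · rw [anti]; exact (dvd_neg).mpr d01
      · rw [self]; exact dvd_zero _
      · exact d12
      · rw [anti]; exact (dvd_neg).mpr d02
      · rw [anti]; exact (dvd_neg).mpr d12
      · rw [self]; exact dvd_zero _
    have hrow : ∀ α, (l : ℤ) ∣ q α ∧ (l : ℤ) ∣ p α := by
      intro α
      have := triv (q α) (-p α) (fun β => by
        have e : p β * q α + q β * (-p α) = Δ2 p q β α := by unfold Δ2; ring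
        rw [e]; exact hall β α)
      exact ⟨this.1, (dvd_neg).mp this.2⟩
    have h1 := (triv 1 0 (fun β => by simpa using (hrow β).2)).1
    have := Int.eq_one_of_dvd_one hl0.le h1
    exact hl.one_lt.ne' (by exact_mod_cast this)
  · intro hg
    ext ⟨t, s⟩
    rw [Set.mem_singleton_iff]
    constructor
    · intro h
      have c01 := cramer_T p q _ h 0 1
      have c02 := cramer_T p q _ h 0 2
      have c12 := cramer_T p q _ h 1 2
      have e1 := zero_of_gcd _ _ _ hg t h.1 c01.1 c02.1 c12.1
      have e2 := zero_of_gcd _ _ _ hg s h.2.1 c01.2 c02.2 c12.2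
      rw [e1, e2]
    · intro h
      rw [h]; exact zero_mem_T p q

/-- `S₁` is nonempty, in coordinates. -/
lemma exists_point_aux (p q : Fin 3 → ℤ) (u : ℍ[ℝ]) (a : Fin 3 → ℍ[ℝ])
    (hu : u.re = 1 / 2 ∧ u.imI = 0 ∧ u.imJ = 0 ∧ u.imK = 0)
    (h0 : (a 0).re = 0 ∧ (a 0).imI = 1 / 2 ∧ (a 0).imJ = 0 ∧ (a 0).imK = 0)
    (h1 : (a 1).re = 0 ∧ (a 1).imI = 0 ∧ (a 1).imJ = 1 / 2 ∧ (a 1).imK = 0)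
    (h2 : (a 2).re = 0 ∧ (a 2).imI = 0 ∧ (a 2).imJ = 0 ∧ (a 2).imK = 1 / 2) :
    inNΩ p q u a (fun _ => 0) := by
  obtain ⟨u0, u1, u2, u3⟩ := hu
  obtain ⟨x0, x1, x2, x3⟩ := h0
  obtain ⟨y0, y1, y2, y3⟩ := h1
  obtain ⟨z0, z1, z2, z3⟩ := h2
  refine ⟨?_, ?_, ?_⟩
  · simp only [pow_two, ← Quaternion.normSq_eq_norm_mul_self, Fin.sum_univ_three, map_zero]
    simp only [Quaternion.normSq_def', u0, u1, u2, u3, x0, x1, x2, x3, y0, y1, y2, y3,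
      z0, z1, z2, z3]
    norm_num
  · intro e he
    simp only [Set.mem_insert_iff, Set.mem_singleton_iff] at he
    rcases he with rfl | rfl | rfl <;>
      simp only [Fin.sum_univ_three, Quaternion.ext_iff] <;>
      simp [qI_re, qI_imI, qI_imJ, qI_imK, qJ_re, qJ_imI, qJ_imJ, qJ_imK,
        qK_re, qK_imI, qK_imJ, qK_imK, u0, u1, u2, u3, x0, x1, x2, x3, y0, y1, y2, y3,
        z0, z1, z2, z3]
  · intro d _
    simp

/-- `S₁` is nonempty: the point `(1/2)(1, i, 0, j, 0, k, 0)`. -/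
lemma exists_point (p q : Fin 3 → ℤ) :
    inNΩ p q (⟨1 / 2, 0, 0, 0⟩ : ℍ[ℝ])
      ![⟨0, 1 / 2, 0, 0⟩, ⟨0, 0, 1 / 2, 0⟩, ⟨0, 0, 0, 1 / 2⟩] (fun _ => 0) :=
  exists_point_aux p q _ _ ⟨rfl, rfl, rfl, rfl⟩ ⟨rfl, rfl, rfl, rfl⟩ ⟨rfl, rfl, rfl, rfl⟩
    ⟨rfl, rfl, rfl, rfl⟩

/-- Lemma 3.2, corrected: assume all minors `Δ_{αβ}` of `Ω` are
nonzero. (1) For every `u ∈ N(Ω)` with `u₁ ≠ 0`, the stabilizer of `u` equals `{1} × T`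
and is finite; (2) `T = {(0,0)}` iff `gcd(Δ₁₂, Δ₁₃, Δ₂₃) = 1`; hence the action on
`S₁ = N(Ω) ∩ {u₁ ≠ 0}` is free iff `gcd(Δ₁₂, Δ₁₃, Δ₂₃) = ±1`. -/
theorem statement15 (p q : Fin 3 → ℤ)
    (hΔ : ∀ α β : Fin 3, α < β → Δ2 p q α β ≠ 0) :
    (∀ (u1 : ℍ[ℝ]) (a b : Fin 3 → ℍ[ℝ]), inNΩ p q u1 a b → u1 ≠ 0 →
      StabΩ p q u1 a b = {x : ℍ[ℝ] × ℝ × ℝ | x.1 = 1 ∧ x.2 ∈ Tset p q} ∧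
      (StabΩ p q u1 a b).Finite) ∧
    (Tset p q = {((0 : ℝ), (0 : ℝ))} ↔
      Int.gcd (Int.gcd (Δ2 p q 0 1) (Δ2 p q 0 2)) (Δ2 p q 1 2) = 1) ∧
    ((∀ (u1 : ℍ[ℝ]) (a b : Fin 3 → ℍ[ℝ]), inNΩ p q u1 a b → u1 ≠ 0 →
        StabΩ p q u1 a b = {((1 : ℍ[ℝ]), (0 : ℝ), (0 : ℝ))}) ↔
      Int.gcd (Int.gcd (Δ2 p q 0 1) (Δ2 p q 0 2)) (Δ2 p q 1 2) = 1) := by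
  refine ⟨fun u1 a b h hu => ⟨stab_eq p q hΔ u1 a b h hu, ?_⟩, T_trivial_iff p q, ?_⟩
  · rw [stab_eq p q hΔ u1 a b h hu]
    refine ((Set.finite_singleton (1 : ℍ[ℝ])).prod
      (T_finite p q (hΔ 0 1 (by decide)))).subset ?_
    rintro x ⟨h1, h2⟩
    exact ⟨h1, h2⟩
  · rw [← T_trivial_iff p q]
    constructor
    · intro hfree
      have hu : (⟨1 / 2, 0, 0, 0⟩ : ℍ[ℝ]) ≠ 0 := by
        intro h
        have := congrArg QuaternionAlgebra.re h
        norm_num at this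
      have h1 := hfree _ _ _ (exists_point p q) hu
      rw [stab_eq p q hΔ _ _ _ (exists_point p q) hu] at h1
      ext ts
      rw [Set.mem_singleton_iff]
      constructor
      · intro h
        have hm : ((1 : ℍ[ℝ]), ts) ∈ {x : ℍ[ℝ] × ℝ × ℝ | x.1 = 1 ∧ x.2 ∈ Tset p q} := ⟨rfl, h⟩
        rw [h1, Set.mem_singleton_iff] at hm
        exact (Prod.mk.injEq _ _ _ _ ▸ hm).2
      · rintro rfl
        exact zero_mem_T p q
    · intro hT u1 a b h hu
      rw [stab_eq p q hΔ u1 a b h hu, hT]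
      ext ⟨l, ts⟩
      simp
end
end

section
/- Suppose the rows p, q, l of Θ have all entries positive. Then for s = (1,1,1,1) and for s = (−1,−1,−1,−1) there is no u ∈ N(Θ) with z_{2α} = s_α·i·z_{2α−1} and w_{2α} = s_α·i·w_{2α−1} for all α ∈ {1,2,3,4}; i.e., the eigenspaces S^{(−,−)}_{(+,+,+)} and S^{(+,+)}_{(−,−,−)} (on which all four quaternionic pairs are rotated with the same sign) have empty intersection with the zero set N(Θ). -/
open scoped Quaternion
open Finset

noncomputable section

/-- Corollary 2.4: if the rows `p, q, l` of `Θ` have all entries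
positive, then for the constant sign vectors `s ≡ 1` and `s ≡ −1` there is no point of
`N(Θ)` whose quaternionic pairs satisfy `z_{2α} = s_α i z_{2α−1}` and
`w_{2α} = s_α i w_{2α−1}` for all `α`. -/
theorem statement19 (p q l : Fin 4 → ℤ)
    (hp : ∀ α, 0 < p α) (hq : ∀ α, 0 < q α) (hl : ∀ α, 0 < l α)
    (s : Fin 4 → ℤ) (hs : (∀ α, s α = 1) ∨ (∀ α, s α = -1)) :
    ¬ ∃ a b : Fin 4 → ℍ[ℝ], inN p q l a b ∧
      ∀ α : Fin 4,
        Qz (b α) = (s α : ℂ) * Complex.I * Qz (a α) ∧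
        Qw (b α) = (s α : ℂ) * Complex.I * Qw (a α) := by
  rintro ⟨a, b, ⟨h1, -, h3⟩, h⟩
  have h4 := h3 p (by simp)
  have h5 := congrArg QuaternionAlgebra.imI h4
  -- a common real sign
  obtain ⟨t, ht, hst⟩ : ∃ t : ℝ, t * t = 1 ∧ ∀ α, (s α : ℂ) = (t : ℂ) := by
    rcases hs with hs | hs
    · exact ⟨1, by norm_num, fun α => by simp [hs α]⟩
    · exact ⟨-1, by norm_num, fun α => by simp [hs α]⟩
  have hb : ∀ α, (b α).re = -(t * (a α).imI) ∧ (b α).imI = t * (a α).re ∧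
      (b α).imJ = t * (a α).imK ∧ (b α).imK = -(t * (a α).imJ) := by
    intro α
    obtain ⟨hz, hw⟩ := h α
    rw [hst α] at hz hw
    have z1 := congrArg Complex.re hz
    have z2 := congrArg Complex.im hz
    have w1 := congrArg Complex.re hw
    have w2 := congrArg Complex.im hw
    simp [Qz, Qw] at z1 z2 w1 w2
    refine ⟨?_, ?_, ?_, ?_⟩ <;> linarith
  have key : ∀ α, ((p α : ℝ) • (star (a α) * b α - star (b α) * a α)).imI
      = 2 * t * ((p α : ℝ) * ‖a α‖ ^ 2) := by
    intro α
    obtain ⟨e1, e2, e3, e4⟩ := hb α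
    have hn : ‖a α‖ ^ 2 = (a α).re ^ 2 + (a α).imI ^ 2 + (a α).imJ ^ 2 + (a α).imK ^ 2 := by
      rw [sq, ← Quaternion.normSq_eq_norm_mul_self, Quaternion.normSq_def']
    rw [hn]
    simp [e1, e2, e3, e4]
    ring
  have hnb : ∀ α, ‖b α‖ ^ 2 = ‖a α‖ ^ 2 := by
    intro α
    obtain ⟨e1, e2, e3, e4⟩ := hb α
    rw [sq, sq, ← Quaternion.normSq_eq_norm_mul_self, ← Quaternion.normSq_eq_norm_mul_self,
      Quaternion.normSq_def', Quaternion.normSq_def', e1, e2, e3, e4]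
    linear_combination ((a α).re ^ 2 + (a α).imI ^ 2 + (a α).imJ ^ 2 + (a α).imK ^ 2) * ht
  have h6 : ∑ α : Fin 4, 2 * t * ((p α : ℝ) * ‖a α‖ ^ 2) = 0 := by
    simp only [← key]
    simp only [Fin.sum_univ_four] at h5 ⊢
    exact h5
  rw [← Finset.mul_sum] at h6
  have h7 : ∑ α : Fin 4, (p α : ℝ) * ‖a α‖ ^ 2 = 0 := by
    linear_combination (t / 2) * h6 - (∑ α : Fin 4, (p α : ℝ) * ‖a α‖ ^ 2) * ht
  have hp' : ∀ α, (0 : ℝ) < p α := fun α => by exact_mod_cast hp α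
  rw [Finset.sum_eq_zero_iff_of_nonneg
    (fun α _ => mul_nonneg (hp' α).le (sq_nonneg _))] at h7
  have h8 : ∀ α, ‖a α‖ ^ 2 = 0 := fun α =>
    (mul_eq_zero.1 (h7 α (Finset.mem_univ α))).resolve_left (hp' α).ne'
  simp only [hnb, h8] at h1
  simp at h1
end
end
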